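/- Let 0 ≤ p1 = p1(n), p2 = p2(n) ≤ 1 and let H ∼ L(n,p1,p2). Then there is a constant c > 0 such that: (1) if p1·p2 ≤ 1/(c·n·log n), then with high probability H does not percolate; (2) if p1·p2 ≥ c/(n·log n) and min{p1,p2} ≥ c·log n/n, then with high probability H percolates. -/

import Mathlib

open Finset Filter

/-- Two clusters `C`, `C'` of `j`-sets can be merged: they are joined by an edge of `E1` (red)
and an edge of `E2` (blue). -/
def Mergeable {V : Type*} [DecidableEq V] (E1 E2 C C' : Finset (Finset V)) : Prop :=
  (∃ J1 ∈ C, ∃ J1' ∈ C', ∃ e1 ∈ E1, J1 ∪ J1' ⊆ e1) ∧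
  (∃ J2 ∈ C, ∃ J2' ∈ C', ∃ e2 ∈ E2, J2 ∪ J2' ⊆ e2)

/-- One elementary merging step of the jigsaw percolation process on the double hypergraph
`(V, E1, E2)`: two distinct mergeable clusters of the current partition `P` are replaced by
their union.  Iterating such pairwise merges as long as possible yields exactly the final
partition of the (deterministic) jigsaw percolation process. -/
def MergeStep {V : Type*} [DecidableEq V] (E1 E2 : Finset (Finset V))
    (P P' : Finset (Finset (Finset V))) : Prop :=
  ∃ C ∈ P, ∃ C' ∈ P, C ≠ C' ∧ Mergeable E1 E2 C C' ∧
    P' = insert (C ∪ C') ((P.erase C).erase C')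

/-- The family `J0` of `j`-sets percolates on the double hypergraph `(V, E1, E2)`:
starting from the partition of `J0` into singletons, a sequence of merges reaches the
partition with a single class. -/
def PercolatesOn {V : Type*} [DecidableEq V] (J0 E1 E2 : Finset (Finset V)) : Prop :=
  Relation.ReflTransGen (MergeStep E1 E2)
    (J0.image fun J => ({J} : Finset (Finset V))) {J0}

/-- The double `k`-graph `(V, E1, E2)` `j`-percolates: the family of all `j`-element subsets
of `V` percolates on `(V, E1, E2)`. -/
def JPercolates {V : Type*} [DecidableEq V] [Fintype V] (j : ℕ)
    (E1 E2 : Finset (Finset V)) : Prop :=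
  PercolatesOn ((Finset.univ : Finset V).powersetCard j) E1 E2
open scoped Classical in
/-- The probability that a pair of independent binomial random subsets of the ground set `K`
(where each element of `K` is included in the first subset with probability `p1` and in the
second with probability `p2`, independently) satisfies the event `A`. -/
noncomputable def probDouble {α : Type*} [DecidableEq α] (K : Finset α) (p1 p2 : ℝ)
    (A : Finset α → Finset α → Prop) : ℝ :=
  ∑ E1 ∈ K.powerset, ∑ E2 ∈ K.powerset,
    if A E1 E2 then
      p1 ^ E1.card * (1 - p1) ^ (K.card - E1.card) *
        p2 ^ E2.card * (1 - p2) ^ (K.card - E2.card)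
    else 0

/-- The probability that the random double `k`-graph `H ~ H_k(n, p1, p2)` on vertex set
`Fin n` (each `k`-set is a red edge with probability `p1` and a blue edge with probability
`p2`, independently over colours and `k`-sets) satisfies the event `A`. -/
noncomputable def probHk (n k : ℕ) (p1 p2 : ℝ)
    (A : Finset (Finset (Fin n)) → Finset (Finset (Fin n)) → Prop) : ℝ :=
  probDouble ((Finset.univ : Finset (Fin n)).powersetCard k) p1 p2 A

/-- The vertex set of the line-graph model `L(n,p1,p2)`: the `2`-element subsets (pairs)
of `[n]`. -/
def PairVertex (n : ℕ) : Type := {A : Finset (Fin n) // A.card = 2}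

instance (n : ℕ) : DecidableEq (PairVertex n) :=
  inferInstanceAs (DecidableEq {A : Finset (Fin n) // A.card = 2})

instance (n : ℕ) : Fintype (PairVertex n) :=
  inferInstanceAs (Fintype {A : Finset (Fin n) // A.card = 2})

open scoped Classical in
/-- The set of potential edges of `L(n,p1,p2)`: the `2`-element sets of vertices (pairs)
whose two members intersect; disjoint pairs never form an edge. -/
noncomputable def lineGroundEdges (n : ℕ) : Finset (Finset (PairVertex n)) :=
  ((Finset.univ : Finset (PairVertex n)).powersetCard 2).filter
    fun e => ∀ A ∈ e, ∀ B ∈ e, A ≠ B → (A.1 ∩ B.1).Nonempty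


noncomputable section JigsawProb
open scoped Classical
set_option linter.unusedSectionVars false

variable {ι : Type*} [Fintype ι]

def wt (p : ι → ℝ) (ω : ι → Bool) : ℝ := ∏ i, if ω i then p i else 1 - p i

def Pr (p : ι → ℝ) (A : (ι → Bool) → Prop) : ℝ := ∑ ω, if A ω then wt p ω else 0

def glue (D : Set ι) (ω ω' : ι → Bool) : ι → Bool := fun i => if i ∈ D then ω i else ω' i

def DetBy (A : (ι → Bool) → Prop) (D : Set ι) : Prop :=
  ∀ ω ω' : ι → Bool, (∀ i ∈ D, ω i = ω' i) → (A ω → A ω')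

lemma DetBy.iff {A : (ι → Bool) → Prop} {D : Set ι} (h : DetBy A D) {ω ω' : ι → Bool}
    (e : ∀ i ∈ D, ω i = ω' i) : A ω ↔ A ω' :=
  ⟨h _ _ e, h _ _ fun i hi => (e i hi).symm⟩

lemma DetBy.mono {A : (ι → Bool) → Prop} {D D' : Set ι} (h : DetBy A D) (hs : D ⊆ D') :
    DetBy A D' := fun _ _ e => h _ _ fun i hi => e i (hs hi)

lemma DetBy.not {A : (ι → Bool) → Prop} {D : Set ι} (h : DetBy A D) :
    DetBy (fun ω => ¬ A ω) D := fun _ _ e hn ha => hn ((h.iff e).2 ha)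

lemma DetBy.and {A B : (ι → Bool) → Prop} {D : Set ι} (h : DetBy A D) (h' : DetBy B D) :
    DetBy (fun ω => A ω ∧ B ω) D := fun _ _ e hn => ⟨h _ _ e hn.1, h' _ _ e hn.2⟩

lemma wt_nonneg {p : ι → ℝ} (hp : ∀ i, 0 ≤ p i ∧ p i ≤ 1) (ω : ι → Bool) : 0 ≤ wt p ω := by
  unfold wt
  refine Finset.prod_nonneg fun i _ => ?_
  split_ifs
  · exact (hp i).1
  · linarith [(hp i).2]

lemma wt_sum (p : ι → ℝ) : ∑ ω, wt p ω = 1 := by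
  unfold wt
  have := Finset.prod_univ_sum (fun _ : ι => (Finset.univ : Finset Bool))
    (fun i b => if b = true then p i else 1 - p i)
  rw [Fintype.piFinset_univ] at this
  rw [← this]
  simp

lemma glue_sum (p : ι → ℝ) (D : Set ι) (h : (ι → Bool) → ℝ) :
    ∑ ω, ∑ ω', wt p ω * wt p ω' * h (glue D ω ω') = ∑ ω, wt p ω * h ω := by
  have h1 : ∑ ω, wt p ω * h ω = ∑ ω, ∑ ω', wt p ω * wt p ω' * h ω := by
    refine Finset.sum_congr rfl fun ω _ => ?_
    rw [← Finset.sum_mul, ← Finset.mul_sum, wt_sum, mul_one]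
  rw [h1, ← Finset.sum_product', ← Finset.sum_product']
  let f : (ι → Bool) × (ι → Bool) → (ι → Bool) × (ι → Bool) :=
    fun x => (glue D x.1 x.2, glue D x.2 x.1)
  have hf : Function.Involutive f := by
    intro x
    ext i <;> simp only [f, glue] <;> split_ifs <;> rfl
  refine Finset.sum_equiv (hf.toPerm f) (by simp) ?_
  rintro ⟨ω, ω'⟩ -
  show _ = wt p (glue D ω ω') * wt p (glue D ω' ω) * h (glue D ω ω')
  congr 1
  simp only [wt, ← Finset.prod_mul_distrib]
  refine Finset.prod_congr rfl fun i _ => ?_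
  by_cases hi : i ∈ D
  · simp [glue, hi]
  · simp [glue, hi, mul_comm]

lemma Pr_eq (p : ι → ℝ) (A : (ι → Bool) → Prop) :
    Pr p A = ∑ ω, wt p ω * (if A ω then 1 else 0) := by
  unfold Pr; simp

lemma Pr_nonneg {p : ι → ℝ} (hp : ∀ i, 0 ≤ p i ∧ p i ≤ 1) (A) : 0 ≤ Pr p A := by
  unfold Pr
  refine Finset.sum_nonneg fun ω _ => ?_
  split_ifs
  · exact wt_nonneg hp ω
  · exact le_rfl

lemma Pr_mono {p : ι → ℝ} (hp : ∀ i, 0 ≤ p i ∧ p i ≤ 1) {A B : (ι → Bool) → Prop}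
    (h : ∀ ω, A ω → B ω) : Pr p A ≤ Pr p B := by
  unfold Pr
  refine Finset.sum_le_sum fun ω _ => ?_
  have := wt_nonneg hp ω
  by_cases hA : A ω
  · simp [hA, h ω hA]
  · simp only [hA, if_false]; split_ifs <;> linarith

lemma Pr_congr {p : ι → ℝ} {A B : (ι → Bool) → Prop}
    (h : ∀ ω, A ω ↔ B ω) : Pr p A = Pr p B := by
  have : A = B := funext fun ω => propext (h ω)
  rw [this]

lemma Pr_true (p : ι → ℝ) : Pr p (fun _ => True) = 1 := by
  unfold Pr; simp [wt_sum]

lemma Pr_not (p : ι → ℝ) (A) : Pr p (fun ω => ¬ A ω) = 1 - Pr p A := by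
  rw [eq_sub_iff_add_eq, ← Pr_true p]
  unfold Pr
  rw [← Finset.sum_add_distrib]
  refine Finset.sum_congr rfl fun ω _ => ?_
  by_cases h : A ω <;> simp [h]

lemma Pr_le_one {p : ι → ℝ} (hp : ∀ i, 0 ≤ p i ∧ p i ≤ 1) (A) : Pr p A ≤ 1 := by
  rw [← Pr_true p]; exact Pr_mono hp fun _ _ => trivial

lemma Pr_or_le {p : ι → ℝ} (hp : ∀ i, 0 ≤ p i ∧ p i ≤ 1) (A B : (ι → Bool) → Prop) :
    Pr p (fun ω => A ω ∨ B ω) ≤ Pr p A + Pr p B := by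
  unfold Pr
  rw [← Finset.sum_add_distrib]
  refine Finset.sum_le_sum fun ω _ => ?_
  have := wt_nonneg hp ω
  by_cases hA : A ω <;> by_cases hB : B ω <;> simp [hA, hB, this]

lemma Pr_exists_le {p : ι → ℝ} (hp : ∀ i, 0 ≤ p i ∧ p i ≤ 1) {κ : Type*} (J : Finset κ)
    (A : κ → (ι → Bool) → Prop) :
    Pr p (fun ω => ∃ j ∈ J, A j ω) ≤ ∑ j ∈ J, Pr p (A j) := by
  induction J using Finset.induction_on with
  | empty => simp [Pr]
  | insert a J ha ih =>
    rw [Finset.sum_insert ha]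
    refine le_trans ?_ (add_le_add_right ih _)
    refine le_trans (Pr_mono hp ?_) (Pr_or_le hp _ _)
    rintro ω ⟨j, hj, h⟩
    rcases Finset.mem_insert.1 hj with rfl | hj
    · exact Or.inl h
    · exact Or.inr ⟨j, hj, h⟩

lemma Pr_indep (p : ι → ℝ) {A B : (ι → Bool) → Prop} {D D' : Set ι} (hA : DetBy A D)
    (hB : DetBy B D') (hD : Disjoint D D') :
    Pr p (fun ω => A ω ∧ B ω) = Pr p A * Pr p B := by
  rw [Pr_eq, ← glue_sum p D, Pr_eq, Pr_eq, Finset.sum_mul_sum]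
  refine Finset.sum_congr rfl fun ω _ => Finset.sum_congr rfl fun ω' _ => ?_
  have h1 : A (glue D ω ω') ↔ A ω := hA.iff fun i hi => by simp [glue, hi]
  have h2 : B (glue D ω ω') ↔ B ω' := hB.iff fun i hi => by
    simp [glue, Set.disjoint_right.1 hD hi]
  rw [h1, h2]
  by_cases a : A ω <;> by_cases b : B ω' <;> simp [a, b]

lemma Pr_cond {p : ι → ℝ} (hp : ∀ i, 0 ≤ p i ∧ p i ≤ 1) {A B : (ι → Bool) → Prop} {D : Set ι}
    {β : ℝ} (h : ∀ ω, A ω → β ≤ Pr p (fun ω' => B (glue D ω ω'))) :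
    Pr p A * β ≤ Pr p B := by
  rw [Pr_eq p B, ← glue_sum p D, Pr_eq, Finset.sum_mul]
  refine Finset.sum_le_sum fun ω _ => ?_
  have h1 : ∑ ω', wt p ω * wt p ω' * (if B (glue D ω ω') then 1 else 0)
      = wt p ω * Pr p (fun ω' => B (glue D ω ω')) := by
    rw [Pr_eq, Finset.mul_sum]
    simp only [mul_assoc]
  rw [h1, mul_assoc]
  refine mul_le_mul_of_nonneg_left ?_ (wt_nonneg hp ω)
  by_cases a : A ω
  · simpa [a] using h ω a
  · simpa [a] using Pr_nonneg hp _

lemma Pr_forall (p : ι → ℝ) {κ : Type*} (J : Finset κ)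
    (A : κ → (ι → Bool) → Prop) (D : κ → Set ι) (hA : ∀ j ∈ J, DetBy (A j) (D j))
    (hD : ∀ i ∈ J, ∀ j ∈ J, i ≠ j → Disjoint (D i) (D j)) :
    Pr p (fun ω => ∀ j ∈ J, A j ω) = ∏ j ∈ J, Pr p (A j) := by
  induction J using Finset.induction_on with
  | empty => simp [Pr_true]
  | insert a J ha ih =>
    rw [Finset.prod_insert ha, ← ih (fun j hj => hA j (Finset.mem_insert_of_mem hj))
      (fun i hi j hj => hD i (Finset.mem_insert_of_mem hi) j (Finset.mem_insert_of_mem hj))]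
    rw [← Pr_indep p (D := D a) (D' := ⋃ j ∈ J, D j) (hA a (Finset.mem_insert_self _ _))]
    · exact Pr_congr fun ω => by simp
    · intro ω ω' e h j hj
      exact hA j (Finset.mem_insert_of_mem hj) _ _ (fun i hi => e i (by
        simp only [Set.mem_iUnion]; exact ⟨j, hj, hi⟩)) (h j hj)
    · simp only [Set.disjoint_iUnion_right]
      intro j hj
      exact hD _ (Finset.mem_insert_self _ _) _ (Finset.mem_insert_of_mem hj)
        (fun e => ha (e ▸ hj))

lemma Pr_coord (p : ι → ℝ) (i : ι) : Pr p (fun ω => ω i = true) = p i := by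
  rw [Pr]
  have := Finset.prod_univ_sum (fun j : ι => if j = i then {true} else (Finset.univ : Finset Bool))
    (fun i b => if b = true then p i else 1 - p i)
  have h2 : ∏ j, (∑ b ∈ (if j = i then {true} else (Finset.univ : Finset Bool)),
      if b = true then p j else 1 - p j) = p i := by
    rw [Finset.prod_eq_single i]
    · simp
    · intro b _ hb; simp [hb]
    · simp
  rw [h2] at this
  rw [this]
  symm
  refine Finset.sum_subset_zero_on_sdiff (Finset.subset_univ _) ?_ ?_
  · intro ω hω
    rw [Finset.mem_sdiff, Fintype.mem_piFinset] at hω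
    rw [if_neg]
    intro h
    refine hω.2 fun j => ?_
    by_cases hj : j = i
    · subst hj; simp [h]
    · simp [hj]
  · intro ω hω
    rw [Fintype.mem_piFinset] at hω
    have := hω i
    rw [if_pos (by simpa using this)]
    rfl

lemma Pr_fiber (p : ι → ℝ) {κ : Type*} (J : Finset κ) (f : (ι → Bool) → κ)
    (hf : ∀ ω, f ω ∈ J) (A : (ι → Bool) → Prop) :
    ∑ k ∈ J, Pr p (fun ω => f ω = k ∧ A ω) = Pr p A := by
  unfold Pr
  rw [Finset.sum_comm]
  refine Finset.sum_congr rfl fun ω _ => ?_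
  rw [Finset.sum_eq_single (f ω)]
  · simp
  · intro b _ hb; rw [if_neg]; exact fun h => hb h.1.symm
  · intro h; exact absurd (hf ω) h

lemma Pr_coord_eq (p : ι → ℝ) (i : ι) (b : Bool) :
    Pr p (fun ω => ω i = b) = if b then p i else 1 - p i := by
  cases b
  · have := Pr_not p (fun ω => ω i = true)
    rw [Pr_coord] at this
    simpa using this
  · simpa using Pr_coord p i

lemma Pr_coords (p : ι → ℝ) (J : Finset ι) (b : ι → Bool) :
    Pr p (fun ω => ∀ i ∈ J, ω i = b i) = ∏ i ∈ J, if b i then p i else 1 - p i := by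
  rw [Pr_forall p J (fun i ω => ω i = b i) (fun i => {i})]
  · exact Finset.prod_congr rfl fun i _ => Pr_coord_eq p i _
  · intro j _ ω ω' e h
    rw [← e j rfl]; exact h
  · intro i _ j _ h
    simpa using h

/-- edge probabilities -/
def ep {α : Type*} (p1 p2 : ℝ) : α × Bool → ℝ := fun i => if i.2 then p1 else p2

lemma ep_mem {α : Type*} {p1 p2 : ℝ} (h1 : 0 ≤ p1 ∧ p1 ≤ 1) (h2 : 0 ≤ p2 ∧ p2 ≤ 1)
    (i : α × Bool) : 0 ≤ ep p1 p2 i ∧ ep p1 p2 i ≤ 1 := by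
  unfold ep; split_ifs <;> assumption

def Ecol {α : Type*} (K : Finset α) (c : Bool) (ω : α × Bool → Bool) : Finset α :=
  K.filter fun e => ω (e, c) = true

lemma probDouble_eq {α : Type*} [Fintype α] [DecidableEq α] (K : Finset α) (p1 p2 : ℝ)
    (A : Finset α → Finset α → Prop) :
    probDouble K p1 p2 A = Pr (ep p1 p2) (fun ω => A (Ecol K true ω) (Ecol K false ω)) := by
  have key : ∀ E1 ∈ K.powerset, ∀ E2 ∈ K.powerset,
      Pr (ep (α := α) p1 p2) (fun ω => Ecol K true ω = E1 ∧ Ecol K false ω = E2) =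
      p1 ^ E1.card * (1 - p1) ^ (K.card - E1.card) *
        p2 ^ E2.card * (1 - p2) ^ (K.card - E2.card) := by
    intro E1 h1 E2 h2
    rw [Finset.mem_powerset] at h1 h2
    have := Pr_coords (ep (α := α) p1 p2) (K ×ˢ Finset.univ)
      (fun i => if i.2 then decide (i.1 ∈ E1) else decide (i.1 ∈ E2))
    rw [Finset.prod_product] at this
    simp only [Fintype.prod_bool, Finset.prod_mul_distrib, ep] at this
    have e1 : ∀ E ⊆ K, ∀ q : ℝ, ∏ x ∈ K, (if decide (x ∈ E) = true then q else 1 - q)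
        = q ^ E.card * (1 - q) ^ (K.card - E.card) := by
      intro E hE q
      simp only [decide_eq_true_eq]
      rw [Finset.prod_ite, Finset.prod_const, Finset.prod_const, Finset.filter_mem_eq_inter,
        Finset.inter_eq_right.2 hE, Finset.filter_notMem_eq_sdiff, Finset.card_sdiff_of_subset hE]
    simp only [if_true, Bool.false_eq_true, if_false] at this
    rw [e1 E1 h1, e1 E2 h2, ← mul_assoc] at this
    rw [← this]
    refine Pr_congr fun ω => ?_
    constructor
    · rintro ⟨rfl, rfl⟩ ⟨e, c⟩ h
      have he : e ∈ K := by simpa using h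
      cases c <;> simp [Ecol, he]
    · intro h
      constructor
      · ext e
        simp only [Ecol, Finset.mem_filter]
        constructor
        · rintro ⟨he, h'⟩
          have := h (e, true) (by simp [he])
          simpa [h'] using this
        · intro he
          have := h (e, true) (by simp [h1 he])
          exact ⟨h1 he, by simpa [he] using this⟩
      · ext e
        simp only [Ecol, Finset.mem_filter]
        constructor
        · rintro ⟨he, h'⟩
          have := h (e, false) (by simp [he])
          simpa [h'] using this
        · intro he
          have := h (e, false) (by simp [h2 he])
          exact ⟨h2 he, by simpa [he] using this⟩
  unfold probDouble
  have hstep : ∀ E1 ∈ K.powerset, ∀ E2 ∈ K.powerset,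
      (if A E1 E2 then p1 ^ E1.card * (1 - p1) ^ (K.card - E1.card) *
        p2 ^ E2.card * (1 - p2) ^ (K.card - E2.card) else 0) =
      Pr (ep (α := α) p1 p2) (fun ω => (Ecol K false ω = E2) ∧ (Ecol K true ω = E1 ∧
        A (Ecol K true ω) (Ecol K false ω))) := by
    intro E1 h1 E2 h2
    rw [← key E1 h1 E2 h2]
    by_cases hA : A E1 E2
    · rw [if_pos hA]
      refine Pr_congr fun ω => ?_
      constructor
      · rintro ⟨h3, h4⟩
        exact ⟨h4, h3, by rw [h3, h4]; exact hA⟩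
      · rintro ⟨h3, h4, -⟩
        exact ⟨h4, h3⟩
    · rw [if_neg hA]
      symm
      rw [Pr]
      refine Finset.sum_eq_zero fun ω _ => ?_
      rw [if_neg]
      rintro ⟨h3, h4, h5⟩
      rw [h3, h4] at h5; exact hA h5
  rw [Finset.sum_congr rfl fun E1 h1 => Finset.sum_congr rfl fun E2 h2 => hstep E1 h1 E2 h2]
  rw [Finset.sum_congr rfl fun E1 h1 => Pr_fiber (ep (α := α) p1 p2) K.powerset
    (fun ω => Ecol K false ω) (by simp [Ecol]) (fun ω => Ecol K true ω = E1 ∧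
        A (Ecol K true ω) (Ecol K false ω))]
  exact Pr_fiber (ep (α := α) p1 p2) K.powerset
    (fun ω => Ecol K true ω) (by simp [Ecol]) (fun ω =>
        A (Ecol K true ω) (Ecol K false ω))

end JigsawProb


noncomputable section JigsawProc
open scoped Classical
set_option linter.unusedSectionVars false
set_option linter.unusedVariables false

variable {V : Type*} [DecidableEq V]

def sing (S : Finset V) : Finset (Finset V) := S.image fun v => {v}

lemma mem_sing {S : Finset V} {J : Finset V} : J ∈ sing S ↔ ∃ v ∈ S, {v} = J := by
  simp [sing]

lemma sing_mem_sing {S : Finset V} {v : V} : {v} ∈ sing S ↔ v ∈ S := by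
  simp [sing]

lemma sing_union (S T : Finset V) : sing (S ∪ T) = sing S ∪ sing T := by
  simp [sing, Finset.image_union]

def Link (E : Finset (Finset V)) (S S' : Finset V) : Prop :=
  ∃ u ∈ S, ∃ u' ∈ S', ∃ e ∈ E, u ∈ e ∧ u' ∈ e

lemma mergeable_sing {E1 E2 : Finset (Finset V)} {S S' : Finset V} :
    Mergeable E1 E2 (sing S) (sing S') ↔ Link E1 S S' ∧ Link E2 S S' := by
  unfold Mergeable Link
  simp only [mem_sing]
  constructor
  · rintro ⟨⟨_, ⟨a, ha, rfl⟩, _, ⟨b, hb, rfl⟩, e, he, h⟩, ⟨_, ⟨a', ha', rfl⟩, _, ⟨b', hb', rfl⟩, e', he', h'⟩⟩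
    exact ⟨⟨a, ha, b, hb, e, he, h (by simp), h (by simp)⟩,
      ⟨a', ha', b', hb', e', he', h' (by simp), h' (by simp)⟩⟩
  · rintro ⟨⟨a, ha, b, hb, e, he, h1, h2⟩, ⟨a', ha', b', hb', e', he', h1', h2'⟩⟩
    refine ⟨⟨_, ⟨a, ha, rfl⟩, _, ⟨b, hb, rfl⟩, e, he, ?_⟩, ⟨_, ⟨a', ha', rfl⟩, _, ⟨b', hb', rfl⟩, e', he', ?_⟩⟩
    · intro x hx; simp at hx; rcases hx with rfl | rfl <;> assumption
    · intro x hx; simp at hx; rcases hx with rfl | rfl <;> assumption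

def gr (E : Finset (Finset V)) (S : Finset V) : SimpleGraph V where
  Adj a b := a ≠ b ∧ a ∈ S ∧ b ∈ S ∧ ∃ e ∈ E, a ∈ e ∧ b ∈ e
  symm := ⟨fun a b ⟨h1, h2, h3, e, he, h4, h5⟩ => ⟨h1.symm, h3, h2, e, he, h5, h4⟩⟩
  loopless := ⟨fun a h => h.1 rfl⟩

def ConnOn (E : Finset (Finset V)) (S : Finset V) : Prop :=
  ∀ u ∈ S, ∀ v ∈ S, (gr E S).Reachable u v

lemma gr_mono {E : Finset (Finset V)} {S T : Finset V} (h : S ⊆ T) : gr E S ≤ gr E T := by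
  intro a b ⟨h1, h2, h3, h4⟩
  exact ⟨h1, h h2, h h3, h4⟩

lemma ConnOn.union {E : Finset (Finset V)} {S T : Finset V} (hS : ConnOn E S) (hT : ConnOn E T)
    (hl : Link E S T) : ConnOn E (S ∪ T) := by
  obtain ⟨a, ha, b, hb, e, he, hae, hbe⟩ := hl
  have hab : (gr E (S ∪ T)).Reachable a b := by
    by_cases h : a = b
    · subst h; exact SimpleGraph.Reachable.refl _
    · exact SimpleGraph.Adj.reachable
        ⟨h, Finset.mem_union_left _ ha, Finset.mem_union_right _ hb, e, he, hae, hbe⟩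
  have key : ∀ u ∈ S ∪ T, (gr E (S ∪ T)).Reachable u a := by
    intro u hu
    rcases Finset.mem_union.1 hu with hu | hu
    · exact (hS u hu a ha).mono (gr_mono Finset.subset_union_left)
    · exact ((hT u hu b hb).mono (gr_mono Finset.subset_union_right)).trans hab.symm
  intro u hu v hv
  exact (key u hu).trans (key v hv).symm

lemma medium [Fintype V] {E1 E2 : Finset (Finset V)} (h : JPercolates 1 E1 E2) {k : ℕ}
    (hk : 2 ≤ k) (hkV : k ≤ Fintype.card V) :
    ∃ S : Finset V, k ≤ S.card ∧ S.card ≤ 2 * k ∧ ConnOn E1 S ∧ ConnOn E2 S := by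
  by_contra hno
  have inv : ∀ P, Relation.ReflTransGen (MergeStep E1 E2)
      (((Finset.univ : Finset V).powersetCard 1).image fun J => ({J} : Finset (Finset V))) P →
      ∀ C ∈ P, ∃ S, C = sing S ∧ S.card < k ∧ ConnOn E1 S ∧ ConnOn E2 S := by
    intro P hP
    induction hP with
    | refl =>
      intro C hC
      simp only [Finset.mem_image, Finset.mem_powersetCard_univ, Finset.card_eq_one] at hC
      obtain ⟨_, ⟨v, rfl⟩, rfl⟩ := hC
      refine ⟨{v}, by simp [sing], by simp; omega, ?_, ?_⟩ <;>
      · intro a ha b hb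
        rw [Finset.mem_singleton] at ha hb
        subst ha; subst hb; exact SimpleGraph.Reachable.refl _
    | tail _ hstep ih =>
      obtain ⟨C, hC, C', hC', _, hm, rfl⟩ := hstep
      intro D hD
      rcases Finset.mem_insert.1 hD with rfl | hD
      · obtain ⟨S, rfl, hS, hS1, hS2⟩ := ih C hC
        obtain ⟨T, rfl, hT, hT1, hT2⟩ := ih C' hC'
        rw [mergeable_sing] at hm
        have c1 := hS1.union hT1 hm.1
        have c2 := hS2.union hT2 hm.2
        refine ⟨S ∪ T, (sing_union S T).symm, ?_, c1, c2⟩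
        by_contra hlt
        exact hno ⟨S ∪ T, by omega, (Finset.card_union_le _ _).trans (by omega), c1, c2⟩
      · exact ih D (Finset.mem_of_mem_erase (Finset.mem_of_mem_erase hD))
  obtain ⟨S, hS, hSk, -⟩ := inv _ h _ (Finset.mem_singleton_self _)
  have : S = Finset.univ := by
    ext v
    simp only [Finset.mem_univ, iff_true]
    rw [← sing_mem_sing, ← hS]
    simp
  rw [this, Finset.card_univ] at hSk
  omega

lemma exists_stable {α : Type*} (r : Finset α → Finset α → Prop)
    (hr : ∀ P P', r P P' → P'.card < P.card) (P0 : Finset α) :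
    ∃ P, Relation.ReflTransGen r P0 P ∧ ∀ P', ¬ r P P' := by
  induction hc : P0.card using Nat.strong_induction_on generalizing P0 with
  | _ m ih =>
    by_cases h : ∃ P', r P0 P'
    · obtain ⟨P', h'⟩ := h
      obtain ⟨P, hP, hs⟩ := ih P'.card (hc ▸ hr _ _ h') P' rfl
      exact ⟨P, Relation.ReflTransGen.head h' hP, hs⟩
    · push Not at h
      exact ⟨P0, Relation.ReflTransGen.refl, h⟩

lemma percolates_of [Fintype V] {E1 E2 : Finset (Finset V)}
    (h : ∀ Q : Finset (Finset V), (∀ v, ∃ S ∈ Q, v ∈ S) →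
      (∀ S ∈ Q, ∀ S' ∈ Q, ∀ v, v ∈ S → v ∈ S' → S = S') →
      (∀ S ∈ Q, ∀ S' ∈ Q, Link E1 S S' → Link E2 S S' → S = S') → Finset.univ ∈ Q) :
    JPercolates 1 E1 E2 := by
  obtain ⟨P, hP, hs⟩ := exists_stable (MergeStep E1 E2) (by
    rintro P P' ⟨C, hC, C', hC', hne, -, rfl⟩
    have h1 := Finset.card_insert_le (C ∪ C') ((P.erase C).erase C')
    have h2 : C' ∈ P.erase C := Finset.mem_erase.2 ⟨hne.symm, hC'⟩
    have h3 := Finset.card_erase_lt_of_mem h2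
    have h4 := Finset.card_erase_lt_of_mem hC
    omega) (((Finset.univ : Finset V).powersetCard 1).image fun J => ({J} : Finset (Finset V)))
  have inv : (∀ C ∈ P, ∃ S : Finset V, S.Nonempty ∧ C = sing S) ∧ (∀ v : V, ∃ C ∈ P, {v} ∈ C) ∧
      (∀ C ∈ P, ∀ C' ∈ P, C ≠ C' → Disjoint C C') := by
    clear hs h
    induction hP with
    | refl =>
      refine ⟨?_, ?_, ?_⟩
      · intro C hC
        simp only [Finset.mem_image, Finset.mem_powersetCard_univ, Finset.card_eq_one] at hC
        obtain ⟨_, ⟨v, rfl⟩, rfl⟩ := hC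
        exact ⟨{v}, by simp, by simp [sing]⟩
      · intro v
        exact ⟨{{v}}, by simp, by simp⟩
      · intro C hC C' hC' hne
        simp only [Finset.mem_image] at hC hC'
        obtain ⟨J, -, rfl⟩ := hC
        obtain ⟨J', -, rfl⟩ := hC'
        simpa using hne
    | @tail b _ _ hstep ih =>
      obtain ⟨C, hC, C', hC', hne, hm, rfl⟩ := hstep
      obtain ⟨i1, i2, i3⟩ := ih
      refine ⟨?_, ?_, ?_⟩
      · intro D hD
        rcases Finset.mem_insert.1 hD with rfl | hD
        · obtain ⟨S, hS, rfl⟩ := i1 C hC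
          obtain ⟨T, hT, rfl⟩ := i1 C' hC'
          exact ⟨S ∪ T, hS.mono Finset.subset_union_left, (sing_union S T).symm⟩
        · exact i1 D (Finset.mem_of_mem_erase (Finset.mem_of_mem_erase hD))
      · intro v
        obtain ⟨D, hD, hv⟩ := i2 v
        by_cases h1 : D = C
        · subst h1; exact ⟨_, Finset.mem_insert_self _ _, Finset.mem_union_left _ hv⟩
        by_cases h2 : D = C'
        · subst h2; exact ⟨_, Finset.mem_insert_self _ _, Finset.mem_union_right _ hv⟩
        · exact ⟨D, Finset.mem_insert_of_mem
            (Finset.mem_erase.2 ⟨h2, Finset.mem_erase.2 ⟨h1, hD⟩⟩), hv⟩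
      · have aux : ∀ D ∈ (b.erase C).erase C', Disjoint D (C ∪ C') := by
          intro D hD
          obtain ⟨h2, hD⟩ := Finset.mem_erase.1 hD
          obtain ⟨h1, hD⟩ := Finset.mem_erase.1 hD
          exact Finset.disjoint_union_right.2 ⟨i3 D hD C hC h1, i3 D hD C' hC' h2⟩
        intro D hD D' hD' hDD
        rcases Finset.mem_insert.1 hD with rfl | hD <;> rcases Finset.mem_insert.1 hD' with rfl | hD'
        · exact absurd rfl hDD
        · exact (aux _ hD').symm
        · exact aux _ hD
        · exact i3 D (Finset.mem_of_mem_erase (Finset.mem_of_mem_erase hD)) D'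
            (Finset.mem_of_mem_erase (Finset.mem_of_mem_erase hD')) hDD
  obtain ⟨i1, i2, i3⟩ := inv
  have hu := h (Finset.univ.filter fun S => sing S ∈ P) (by
    intro v
    obtain ⟨C, hC, hv⟩ := i2 v
    obtain ⟨S, -, rfl⟩ := i1 C hC
    exact ⟨S, by simpa using hC, sing_mem_sing.1 hv⟩) (by
    intro S hS S' hS' v hv hv'
    by_contra hne
    rw [Finset.mem_filter] at hS hS'
    refine Finset.disjoint_left.1 (i3 _ hS.2 _ hS'.2 ?_) (sing_mem_sing.2 hv) (sing_mem_sing.2 hv')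
    intro he
    apply hne
    ext v
    rw [← sing_mem_sing, he, sing_mem_sing]) (by
    intro S hS S' hS' h1 h2
    by_contra hne
    rw [Finset.mem_filter] at hS hS'
    refine hs _ ⟨sing S, hS.2, sing S', hS'.2, ?_, mergeable_sing.2 ⟨h1, h2⟩, rfl⟩
    intro he
    apply hne
    ext v
    rw [← sing_mem_sing, he, sing_mem_sing])
  rw [Finset.mem_filter] at hu
  have hJ : sing (Finset.univ : Finset V) = (Finset.univ : Finset V).powersetCard 1 := by
    ext J
    simp [mem_sing, Finset.card_eq_one, eq_comm]
  have hPeq : P = {(Finset.univ : Finset V).powersetCard 1} := by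
    rw [← hJ]
    ext C
    rw [Finset.mem_singleton]
    constructor
    · intro hC
      by_contra hne
      obtain ⟨S, ⟨v, hv⟩, rfl⟩ := i1 C hC
      exact Finset.disjoint_left.1 (i3 _ hC _ hu.2 hne) (sing_mem_sing.2 hv)
        (sing_mem_sing.2 (Finset.mem_univ v))
    · rintro rfl; exact hu.2
  unfold JPercolates PercolatesOn
  rw [← hPeq]
  exact hP

end JigsawProc


noncomputable section JigsawLower
open scoped Classical
set_option linter.unusedSectionVars false
set_option linter.unusedVariables false

def TreeFn {r : ℕ} (f : Fin (r + 1) → Fin (r + 1)) : Prop :=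
  ∃ d : Fin (r + 1) → ℕ, ∀ v, v ≠ 0 → d (f v) < d v

lemma TreeFn.ne {r : ℕ} {f : Fin (r + 1) → Fin (r + 1)} (hf : TreeFn f) {v} (hv : v ≠ 0) :
    f v ≠ v := by
  obtain ⟨d, hd⟩ := hf
  intro h
  have := hd v hv
  rw [h] at this
  omega

variable {V : Type*} [DecidableEq V] [Fintype V]

lemma reach_step {G : SimpleGraph V} {u t : V} (h : G.Reachable u t) (hne : u ≠ t) :
    ∃ w, G.Adj u w ∧ G.dist w t < G.dist u t := by
  obtain ⟨p, hp⟩ := h.exists_walk_length_eq_dist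
  cases p with
  | nil => exact absurd rfl hne
  | cons hadj q =>
    refine ⟨_, hadj, ?_⟩
    rw [← hp, SimpleGraph.Walk.length_cons]
    have := SimpleGraph.dist_le q
    omega

lemma conn_tree {r : ℕ} {E : Finset (Finset V)} (φ : Fin (r + 1) ↪ V)
    (h : ConnOn E (Finset.univ.image φ)) :
    ∃ f, TreeFn f ∧ ∀ v, v ≠ 0 → ∃ e ∈ E, φ v ∈ e ∧ φ (f v) ∈ e := by
  have key : ∀ v : Fin (r + 1), v ≠ 0 → ∃ w : Fin (r + 1),
      (gr E (Finset.univ.image φ)).dist (φ w) (φ 0) < (gr E (Finset.univ.image φ)).dist (φ v) (φ 0) ∧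
      ∃ e ∈ E, φ v ∈ e ∧ φ w ∈ e := by
    intro v hv
    obtain ⟨x, hadj, hlt⟩ := reach_step (h (φ v) (by simp) (φ 0) (by simp))
      (fun e => hv (φ.injective e))
    obtain ⟨h1, h2, h3, e, he, h4, h5⟩ := hadj
    rw [Finset.mem_image] at h3
    obtain ⟨w, -, rfl⟩ := h3
    exact ⟨w, hlt, e, he, h4, h5⟩
  choose! f hf using key
  exact ⟨f, ⟨fun v => (gr E (Finset.univ.image φ)).dist (φ v) (φ 0), fun v hv => (hf v hv).1⟩,
    fun v hv => (hf v hv).2⟩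

lemma code_exists (R : V → V → Prop) (Δ : ℕ) (hΔ : 0 < Δ)
    (hR : ∀ u, (Finset.univ.filter fun v => R u v).card ≤ Δ) :
    ∃ code : V → V → Fin Δ, ∀ u, Set.InjOn (code u) {v | R u v} := by
  have : ∀ u, ∃ g : V → Fin Δ, Set.InjOn g {v | R u v} := by
    intro u
    have hc : Fintype.card {v // R u v} ≤ Fintype.card (Fin Δ) := by
      rw [Fintype.card_subtype, Fintype.card_fin]; exact hR u
    obtain ⟨g⟩ := Function.Embedding.nonempty_of_card_le hc
    refine ⟨fun v => if h : R u v then g ⟨v, h⟩ else ⟨0, hΔ⟩, ?_⟩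
    intro a ha b hb hab
    have ha' : R u a := ha
    have hb' : R u b := hb
    simp only [ha', hb', dif_pos] at hab
    simpa using g.injective hab
  choose code hcode using this
  exact ⟨code, hcode⟩

lemma count_compat (R : V → V → Prop) (Δ : ℕ) (hΔ : 0 < Δ)
    (hR : ∀ u, (Finset.univ.filter fun v => R u v).card ≤ Δ) {r : ℕ}
    (f : Fin (r + 1) → Fin (r + 1)) (hf : TreeFn f) :
    (Finset.univ.filter fun φ : Fin (r + 1) ↪ V => ∀ v, v ≠ 0 → R (φ (f v)) (φ v)).card
      ≤ Fintype.card V * Δ ^ r := by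
  obtain ⟨code, hcode⟩ := code_exists R Δ hΔ hR
  have hcard : (Finset.univ : Finset (V × (Fin r → Fin Δ))).card = Fintype.card V * Δ ^ r := by
    rw [Finset.card_univ, Fintype.card_prod, Fintype.card_fun, Fintype.card_fin, Fintype.card_fin]
  rw [← hcard]
  refine Finset.card_le_card_of_injOn
    (fun φ => (φ 0, fun i => code (φ (f i.succ)) (φ i.succ))) (by simp) ?_
  intro φ hφ ψ hψ he
  simp only [Finset.coe_filter, Finset.mem_univ, true_and, Set.mem_ofPred_eq] at hφ hψ
  obtain ⟨h0, h1⟩ := Prod.mk.inj he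
  obtain ⟨d, hd⟩ := hf
  have key : ∀ m v, d v < m → φ v = ψ v := by
    intro m
    induction m with
    | zero => intro v h; omega
    | succ m ih =>
      intro v h
      by_cases hv : v = 0
      · subst hv; exact h0
      · obtain ⟨i, rfl⟩ := Fin.exists_succ_eq.2 hv
        have h2 := ih (f i.succ) (by have := hd _ hv; omega)
        have h3 := congrFun h1 i
        have a := hφ _ hv
        have b := hψ _ hv
        rw [← h2] at h3 b
        exact hcode _ a b h3
  ext v
  exact key _ v (Nat.lt_succ_self _)

lemma tree_prob {r : ℕ} (p1 p2 : ℝ) (φ : Fin (r + 1) ↪ V) (f g : Fin (r + 1) → Fin (r + 1))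
    (hf : TreeFn f) (hg : TreeFn g) :
    Pr (ep (α := Finset V) p1 p2) (fun ω => ∀ v, v ≠ 0 → ω ({φ v, φ (f v)}, true) = true ∧
      ω ({φ v, φ (g v)}, false) = true) = (p1 * p2) ^ r := by
  have inj : ∀ f : Fin (r + 1) → Fin (r + 1), TreeFn f →
      Function.Injective (fun i : Fin r => ({φ i.succ, φ (f i.succ)} : Finset V)) := by
    intro f hf i j hij
    by_contra hne
    have hne' : i.succ ≠ j.succ := fun h => hne (Fin.succ_injective _ h)
    simp only at hij
    have h1 : φ i.succ ∈ ({φ j.succ, φ (f j.succ)} : Finset V) := by rw [← hij]; simp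
    have h2 : φ j.succ ∈ ({φ i.succ, φ (f i.succ)} : Finset V) := by rw [hij]; simp
    simp only [Finset.mem_insert, Finset.mem_singleton, φ.injective.eq_iff] at h1 h2
    obtain ⟨d, hd⟩ := hf
    have h3 := hd i.succ (Fin.succ_ne_zero i)
    have h4 := hd j.succ (Fin.succ_ne_zero j)
    rcases h1 with h1 | h1
    · exact hne' h1
    rcases h2 with h2 | h2
    · exact hne' h2.symm
    rw [← h2] at h3; rw [← h1] at h4
    omega
  have := Pr_coords (ep (α := Finset V) p1 p2)
    ((Finset.univ.image fun i : Fin r => (({φ i.succ, φ (f i.succ)} : Finset V), true)) ∪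
     (Finset.univ.image fun i : Fin r => (({φ i.succ, φ (g i.succ)} : Finset V), false)))
    (fun _ => true)
  rw [Finset.prod_union, Finset.prod_image, Finset.prod_image] at this
  · simp only [if_true, ep, Finset.prod_const, Finset.card_univ, Fintype.card_fin,
      Bool.false_eq_true, if_false, ← mul_pow] at this
    rw [← this]
    refine Pr_congr fun ω => ?_
    constructor
    · intro h i hi
      rw [Finset.mem_union, Finset.mem_image, Finset.mem_image] at hi
      rcases hi with ⟨j, -, rfl⟩ | ⟨j, -, rfl⟩
      · exact (h _ (Fin.succ_ne_zero j)).1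
      · exact (h _ (Fin.succ_ne_zero j)).2
    · intro h v hv
      obtain ⟨i, rfl⟩ := Fin.exists_succ_eq.2 hv
      exact ⟨h _ (Finset.mem_union_left _ (Finset.mem_image.2 ⟨i, by simp, rfl⟩)),
        h _ (Finset.mem_union_right _ (Finset.mem_image.2 ⟨i, by simp, rfl⟩))⟩
  · intro i _ j _ h; exact inj g hg (Prod.mk.inj h).1
  · intro i _ j _ h; exact inj f hf (Prod.mk.inj h).1
  · rw [Finset.disjoint_left]
    intro a ha hb
    rw [Finset.mem_image] at ha hb
    obtain ⟨i, -, rfl⟩ := ha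
    obtain ⟨j, -, h⟩ := hb
    simpa using (Prod.mk.inj h).2

lemma symmetrize (r : ℕ) (F : Finset V → ℝ) :
    (∑ S ∈ (Finset.univ : Finset V).powersetCard r, F S) * (r.factorial : ℝ) =
      ∑ φ : Fin r ↪ V, F (Finset.univ.image φ) := by
  have h1 : ∑ φ : Fin r ↪ V, F (Finset.univ.image φ) =
      ∑ S ∈ (Finset.univ : Finset V).powersetCard r,
        ∑ φ ∈ (Finset.univ : Finset (Fin r ↪ V)).filter
          (fun φ : Fin r ↪ V => Finset.univ.image φ = S),
          F (Finset.univ.image φ) := by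
    rw [Finset.sum_fiberwise_of_maps_to]
    intro φ _
    simp [Finset.card_image_of_injective _ φ.injective]
  rw [h1, Finset.sum_mul]
  refine Finset.sum_congr rfl fun S hS => ?_
  rw [Finset.mem_powersetCard_univ] at hS
  rw [Finset.sum_congr rfl (g := fun _ => F S) (by
    intro φ hφ; rw [(Finset.mem_filter.1 hφ).2])]
  rw [Finset.sum_const, nsmul_eq_mul, mul_comm]
  congr 2
  have e : Fintype.card (Fin r ≃ {v // v ∈ S}) = r.factorial := by
    have e0 : Fin r ≃ {v // v ∈ S} := (S.equivFinOfCardEq hS).symm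
    rw [Fintype.card_equiv e0, Fintype.card_fin]
  rw [← e, ← Fintype.card_subtype]
  refine Fintype.card_congr (Equiv.symm ?_)
  refine
    { toFun := fun φ => Equiv.ofBijective
        (fun i => ⟨φ.1 i, φ.2.subset (Finset.mem_image_of_mem _ (Finset.mem_univ i))⟩) ?_
      invFun := fun σ => ⟨σ.toEmbedding.trans (Function.Embedding.subtype _), ?_⟩
      left_inv := ?_
      right_inv := ?_ }
  · constructor
    · intro i j hij
      exact φ.1.injective (by simpa using hij)
    · rintro ⟨v, hv⟩
      obtain ⟨i, -, hi⟩ := Finset.mem_image.1 (φ.2.symm.subset hv)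
      exact ⟨i, by simpa using hi⟩
  · ext v
    simp only [Finset.mem_image, Finset.mem_univ, true_and]
    constructor
    · rintro ⟨i, rfl⟩
      exact (σ i).2
    · intro hv
      exact ⟨σ.symm ⟨v, hv⟩, by simp⟩
  · intro φ; ext i; rfl
  · intro σ; ext i; rfl

lemma part1_bound (K : Finset (Finset V)) (hK : ∀ e ∈ K, e.card = 2) (Δ : ℕ) (hΔ : 0 < Δ)
    (hR : ∀ u, (Finset.univ.filter fun v => v ≠ u ∧ {u, v} ∈ K).card ≤ Δ) (r : ℕ)
    {p1 p2 : ℝ} (h1 : 0 ≤ p1 ∧ p1 ≤ 1) (h2 : 0 ≤ p2 ∧ p2 ≤ 1) :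
    Pr (ep (α := Finset V) p1 p2) (fun ω => ∃ S : Finset V, S.card = r + 1 ∧
      ConnOn (Ecol K true ω) S ∧ ConnOn (Ecol K false ω) S) * ((r + 1).factorial : ℝ) ≤
      (Fintype.card V * Δ ^ r : ℕ) * (((r + 1 : ℕ) : ℝ) ^ (r + 1)) ^ 2 * (p1 * p2) ^ r := by
  have hp := ep_mem (α := Finset V) h1 h2
  set F : Finset V → ℝ := fun S => Pr (ep (α := Finset V) p1 p2)
    (fun ω => ConnOn (Ecol K true ω) S ∧ ConnOn (Ecol K false ω) S) with hF
  have step1 : Pr (ep (α := Finset V) p1 p2) (fun ω => ∃ S : Finset V, S.card = r + 1 ∧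
      ConnOn (Ecol K true ω) S ∧ ConnOn (Ecol K false ω) S) ≤
      ∑ S ∈ (Finset.univ : Finset V).powersetCard (r + 1), F S := by
    refine le_trans (Pr_mono hp ?_) (Pr_exists_le hp _ _)
    rintro ω ⟨S, hS, h⟩
    exact ⟨S, by simpa using hS, h⟩
  have hpp : 0 ≤ (p1 * p2) ^ r := pow_nonneg (mul_nonneg h1.1 h2.1) r
  refine (mul_le_mul_of_nonneg_right step1 (by positivity)).trans ?_
  rw [symmetrize]
  set TF : Finset (Fin (r + 1) → Fin (r + 1)) := Finset.univ.filter TreeFn with hTF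
  have hTFc : (TF.card : ℝ) ≤ ((r + 1 : ℕ) : ℝ) ^ (r + 1) := by
    have : TF.card ≤ (r + 1) ^ (r + 1) := by
      refine (Finset.card_le_univ _).trans ?_
      simp
    exact_mod_cast this
  have step2 : ∀ φ : Fin (r + 1) ↪ V, F (Finset.univ.image φ) ≤
      ∑ f ∈ TF, if (∀ v, v ≠ 0 → (φ v ≠ φ (f v) ∧ {φ (f v), φ v} ∈ K)) then
        (((r + 1 : ℕ) : ℝ) ^ (r + 1)) * (p1 * p2) ^ r else 0 := by
    intro φ
    have hedge : ∀ c ω f, TreeFn f → (∀ v, v ≠ 0 → ∃ e ∈ Ecol K c ω, φ v ∈ e ∧ φ (f v) ∈ e) →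
        ∀ v, v ≠ 0 → (({φ v, φ (f v)} : Finset V) ∈ K ∧ ω ({φ v, φ (f v)}, c) = true) := by
      intro c ω f hf h v hv
      obtain ⟨e, he, h3, h4⟩ := h v hv
      rw [Ecol, Finset.mem_filter] at he
      have : ({φ v, φ (f v)} : Finset V) = e := by
        refine Finset.eq_of_subset_of_card_le ?_ ?_
        · intro x hx; simp at hx; rcases hx with rfl | rfl <;> assumption
        · rw [hK e he.1, Finset.card_pair]
          exact fun h => hf.ne hv (φ.injective h.symm)
      rw [this]; exact he
    set TF' := TF.filter fun f => ∀ v, v ≠ 0 → (φ v ≠ φ (f v) ∧ {φ (f v), φ v} ∈ K) with hTF'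
    have : F (Finset.univ.image φ) ≤ ∑ f ∈ TF', ∑ g ∈ TF, (p1 * p2) ^ r := by
      rw [← Finset.sum_product']
      have e : ∀ x ∈ TF' ×ˢ TF, (p1 * p2) ^ r = Pr (ep (α := Finset V) p1 p2) (fun ω =>
          ∀ v, v ≠ 0 → ω ({φ v, φ (x.1 v)}, true) = true ∧
          ω ({φ v, φ (x.2 v)}, false) = true) := by
        intro x hx
        rw [Finset.mem_product, Finset.mem_filter, hTF, Finset.mem_filter, Finset.mem_filter] at hx
        rw [tree_prob p1 p2 φ x.1 x.2 hx.1.1.2 hx.2.2]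
      rw [Finset.sum_congr rfl e]
      refine le_trans (Pr_mono hp ?_) (Pr_exists_le hp _ _)
      rintro ω ⟨c1, c2⟩
      obtain ⟨f, hf, hf'⟩ := conn_tree φ c1
      obtain ⟨g, hg, hg'⟩ := conn_tree φ c2
      have k1 := hedge _ _ f hf hf'
      have k2 := hedge _ _ g hg hg'
      refine ⟨(f, g), ?_, fun v hv => ⟨(k1 v hv).2, (k2 v hv).2⟩⟩
      simp only [Finset.mem_product, hTF', hTF, Finset.mem_filter, Finset.mem_univ, true_and]
      refine ⟨⟨hf, fun v hv => ⟨fun h => hf.ne hv (φ.injective h.symm), ?_⟩⟩, hg⟩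
      rw [Finset.pair_comm]; exact (k1 v hv).1
    refine this.trans ?_
    rw [← Finset.sum_filter]
    refine Finset.sum_le_sum fun f _ => ?_
    rw [Finset.sum_const, nsmul_eq_mul]
    exact mul_le_mul_of_nonneg_right hTFc hpp
  refine (Finset.sum_le_sum fun φ _ => step2 φ).trans ?_
  rw [Finset.sum_comm]
  have step3 : ∀ f ∈ TF, (∑ φ : Fin (r + 1) ↪ V,
      if (∀ v, v ≠ 0 → (φ v ≠ φ (f v) ∧ {φ (f v), φ v} ∈ K)) then
        (((r + 1 : ℕ) : ℝ) ^ (r + 1)) * (p1 * p2) ^ r else 0) ≤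
      ((Fintype.card V * Δ ^ r : ℕ) : ℝ) * ((((r + 1 : ℕ) : ℝ) ^ (r + 1)) * (p1 * p2) ^ r) := by
    intro f hf
    rw [← Finset.sum_filter, Finset.sum_const, nsmul_eq_mul]
    refine mul_le_mul_of_nonneg_right ?_ (by positivity)
    have := count_compat (fun u v => v ≠ u ∧ {u, v} ∈ K) Δ hΔ (fun u => by convert hR u) f (Finset.mem_filter.1 hf).2
    exact_mod_cast this
  refine (Finset.sum_le_sum step3).trans ?_
  rw [Finset.sum_const, nsmul_eq_mul]
  refine (mul_le_mul_of_nonneg_right hTFc (by positivity)).trans (le_of_eq ?_)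
  ring

end JigsawLower


noncomputable section JigsawUpper
open scoped Classical
set_option linter.unusedSectionVars false
set_option linter.unusedVariables false

variable {V : Type*} [DecidableEq V] [Fintype V]

def Jn (c : Bool) (w : V) (S : Finset V) (ω : Finset V × Bool → Bool) : Prop :=
  ∃ u ∈ S, ω ({w, u}, c) = true

def Join (w : V) (S : Finset V) (ω : Finset V × Bool → Bool) : Prop :=
  Jn true w S ω ∧ Jn false w S ω

inductive Grown (ω : Finset V × Bool → Bool) : Finset V → Prop
  | base (r : V) : Grown ω {r}
  | step (S : Finset V) (w : V) : Grown ω S → w ∉ S → Join w S ω → Grown ω (insert w S)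

def Seed (Z : Finset V) (t : ℕ) (ω : Finset V × Bool → Bool) : Prop :=
  ∃ S ⊆ Z, S.card = t ∧ Grown ω S

def qv (p1 p2 : ℝ) (t : ℕ) : ℝ := (1 - (1 - p1) ^ t) * (1 - (1 - p2) ^ t)

def joinD (w : V) (S : Finset V) : Set (Finset V × Bool) := {i | ∃ u ∈ S, i.1 = {w, u}}

def inD (Z : Finset V) : Set (Finset V × Bool) := {i | i.1 ⊆ Z ∧ i.1.card = 2}

lemma mem_joinD {w : V} {S : Finset V} {i : Finset V × Bool} :
    i ∈ joinD w S ↔ ∃ u ∈ S, i.1 = {w, u} := Iff.rfl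

lemma mem_inD {Z : Finset V} {i : Finset V × Bool} :
    i ∈ inD Z ↔ i.1 ⊆ Z ∧ i.1.card = 2 := Iff.rfl

lemma join_det (w : V) (S : Finset V) : DetBy (Join w S) (joinD w S) := by
  rintro ω ω' e ⟨⟨u, hu, h⟩, ⟨u', hu', h'⟩⟩
  refine ⟨⟨u, hu, ?_⟩, ⟨u', hu', ?_⟩⟩
  · rw [← e _ (mem_joinD.2 ⟨u, hu, rfl⟩)]; exact h
  · rw [← e _ (mem_joinD.2 ⟨u', hu', rfl⟩)]; exact h'

lemma pair_inj {w u u' : V} (h1 : w ≠ u) (h : ({w, u} : Finset V) = {w, u'}) : u = u' := by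
  have : u ∈ ({w, u'} : Finset V) := by rw [← h]; simp
  simp only [Finset.mem_insert, Finset.mem_singleton] at this
  rcases this with h | h
  · exact absurd h.symm h1
  · exact h

lemma prob_Jn (p1 p2 : ℝ) (c : Bool) (w : V) (S : Finset V) (hw : w ∉ S) :
    Pr (ep (α := Finset V) p1 p2) (Jn c w S) = 1 - (1 - (if c then p1 else p2)) ^ S.card := by
  have h1 := Pr_not (ep (α := Finset V) p1 p2) (fun ω => ¬ Jn c w S ω)
  simp only [not_not] at h1
  rw [show Pr (ep (α := Finset V) p1 p2) (Jn c w S) = _ from h1]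
  congr 1
  have h2 := Pr_coords (ep (α := Finset V) p1 p2)
    (S.image fun u => (({w, u} : Finset V), c)) (fun _ => false)
  rw [Finset.prod_image] at h2
  · have h3 : ∏ x ∈ S, (if ((fun _ => false : Finset V × Bool → Bool) (({w, x} : Finset V), c)) = true
        then ep (α := Finset V) p1 p2 (({w, x} : Finset V), c)
        else 1 - ep (α := Finset V) p1 p2 (({w, x} : Finset V), c)) =
        (1 - (if c then p1 else p2)) ^ S.card := by
      rw [← Finset.prod_const]
      refine Finset.prod_congr rfl fun x _ => ?_
      simp [ep]
    refine Eq.trans ?_ (h2.trans ?_)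
    rotate_left
    · simpa [ep] using h3
    refine Pr_congr fun ω => ?_
    simp [Jn]
  · intro u hu u' hu' h
    refine pair_inj ?_ (Prod.mk.inj h).1
    rintro rfl; exact hw hu

lemma prob_Join (p1 p2 : ℝ) (w : V) (S : Finset V) (hw : w ∉ S) :
    Pr (ep (α := Finset V) p1 p2) (Join w S) = qv p1 p2 S.card := by
  have hd : ∀ c, DetBy (Jn c w S) {i : Finset V × Bool | i.2 = c} := by
    rintro c ω ω' e ⟨u, hu, h⟩
    exact ⟨u, hu, by rw [← e _ rfl]; exact h⟩
  have := Pr_indep (ep (α := Finset V) p1 p2) (hd true) (hd false) (by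
    rw [Set.disjoint_left]
    intro i h1 h2
    have h1' : i.2 = true := h1
    have h2' : i.2 = false := h2
    rw [h1'] at h2'; exact absurd h2' (by simp))
  rw [prob_Jn p1 p2 _ _ _ hw, prob_Jn p1 p2 _ _ _ hw] at this
  have e : Pr (ep (α := Finset V) p1 p2) (Join w S) =
    Pr (ep (α := Finset V) p1 p2) (fun ω => Jn true w S ω ∧ Jn false w S ω) := rfl
  rw [qv, e, this]
  simp

lemma prob_nojoin (p1 p2 : ℝ) (W : Finset V) (S : Finset V) (hw : Disjoint W S) :
    Pr (ep (α := Finset V) p1 p2) (fun ω => ∀ w ∈ W, ¬ Join w S ω) =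
      (1 - qv p1 p2 S.card) ^ W.card := by
  rw [Pr_forall _ W (fun w ω => ¬ Join w S ω) (fun w => joinD w S) (fun w _ => (join_det w S).not)]
  · rw [← Finset.prod_const]
    refine Finset.prod_congr rfl fun w h => ?_
    rw [Pr_not, prob_Join p1 p2 w S (Finset.disjoint_left.1 hw h)]
  · intro w h w' h' hne
    rw [Set.disjoint_left]
    intro i hi hi'
    obtain ⟨u, hu, e⟩ := mem_joinD.1 hi
    obtain ⟨u', hu', e'⟩ := mem_joinD.1 hi'
    have : w ∈ ({w', u'} : Finset V) := by rw [← e', e]; simp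
    simp only [Finset.mem_insert, Finset.mem_singleton] at this
    rcases this with h1 | h1
    · exact hne h1
    · rw [h1] at h; exact Finset.disjoint_left.1 hw h hu'

lemma grown_congr {Z : Finset V} {ω ω' : Finset V × Bool → Bool} (e : ∀ i ∈ inD Z, ω i = ω' i)
    {S : Finset V} (h : Grown ω S) (hS : S ⊆ Z) : Grown ω' S := by
  induction h with
  | base r => exact Grown.base r
  | step S w _ hw hj ih =>
    have hSZ : S ⊆ Z := (Finset.subset_insert w S).trans hS
    have hwZ : w ∈ Z := hS (Finset.mem_insert_self _ _)
    refine Grown.step S w (ih hSZ) hw (join_det w S ω ω' ?_ hj)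
    intro i hi
    obtain ⟨u, hu, h⟩ := mem_joinD.1 hi
    refine e i (mem_inD.2 ⟨?_, ?_⟩)
    · rw [h]; intro x hx; simp at hx; rcases hx with rfl | rfl
      · exact hwZ
      · exact hSZ hu
    · rw [h, Finset.card_pair]; rintro rfl; exact hw hu

lemma seed_det (Z : Finset V) (t : ℕ) : DetBy (Seed Z t) (inD Z) := by
  rintro ω ω' e ⟨S, hS, ht, hg⟩
  exact ⟨S, hS, ht, grown_congr e hg hS⟩

lemma seed_step {p1 p2 : ℝ} (h1 : 0 ≤ p1 ∧ p1 ≤ 1) (h2 : 0 ≤ p2 ∧ p2 ≤ 1) (Z B : Finset V)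
    (hZB : Disjoint Z B) (t : ℕ) :
    Pr (ep (α := Finset V) p1 p2) (Seed Z t) * (1 - (1 - qv p1 p2 t) ^ B.card) ≤
      Pr (ep (α := Finset V) p1 p2) (Seed (Z ∪ B) (t + 1)) := by
  have hp := ep_mem (α := Finset V) h1 h2
  refine Pr_cond hp (D := inD Z) ?_
  rintro ω ⟨S, hS, ht, hg⟩
  have hBS : Disjoint B S := (hZB.mono_left hS).symm
  have := prob_nojoin p1 p2 B S hBS
  rw [ht] at this
  rw [← this, ← Pr_not]
  refine Pr_mono hp ?_
  intro ω' hω'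
  push Not at hω'
  obtain ⟨w, hw, hj⟩ := hω'
  have hwS := Finset.disjoint_left.1 hBS hw
  have hwZ := Finset.disjoint_right.1 hZB hw
  refine ⟨insert w S, ?_, ?_, Grown.step S w ?_ hwS ?_⟩
  · intro x hx
    rcases Finset.mem_insert.1 hx with rfl | hx
    · exact Finset.mem_union_right _ hw
    · exact Finset.mem_union_left _ (hS hx)
  · rw [Finset.card_insert_of_notMem hwS, ht]
  · exact grown_congr (fun i hi => by simp [glue, hi]) hg hS
  · refine join_det w S ω' _ ?_ hj
    intro i hi
    obtain ⟨u, hu, h⟩ := mem_joinD.1 hi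
    have : i ∉ inD Z := by
      intro hi'
      refine hwZ ((mem_inD.1 hi').1 ?_)
      rw [h]; simp
    simp [glue, this]

lemma qv_mem {p1 p2 : ℝ} (h1 : 0 ≤ p1 ∧ p1 ≤ 1) (h2 : 0 ≤ p2 ∧ p2 ≤ 1) (t : ℕ) :
    0 ≤ qv p1 p2 t ∧ qv p1 p2 t ≤ 1 := by
  have a : ∀ p : ℝ, 0 ≤ p ∧ p ≤ 1 → 0 ≤ 1 - (1 - p) ^ t ∧ 1 - (1 - p) ^ t ≤ 1 := by
    intro p hp
    have := pow_le_one₀ (n := t) (by linarith [hp.2] : 0 ≤ 1 - p) (by linarith [hp.1])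
    have := pow_nonneg (by linarith [hp.2] : 0 ≤ 1 - p) t
    constructor <;> linarith
  exact ⟨mul_nonneg (a p1 h1).1 (a p2 h2).1, mul_le_one₀ (a p1 h1).2 (a p2 h2).1 (a p2 h2).2⟩

lemma seed_prod {p1 p2 : ℝ} (h1 : 0 ≤ p1 ∧ p1 ≤ 1) (h2 : 0 ≤ p2 ∧ p2 ≤ 1) (b : ℕ → ℕ) (T : ℕ)
    (hT : 1 ≤ T) : ∀ (Z : Finset V), 1 + ∑ t ∈ Finset.Ico 1 T, b t ≤ Z.card →
    ∏ t ∈ Finset.Ico 1 T, (1 - (1 - qv p1 p2 t) ^ b t) ≤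
      Pr (ep (α := Finset V) p1 p2) (Seed Z T) := by
  induction T, hT using Nat.le_induction with
  | base =>
    intro Z hZ
    simp only [Finset.Ico_self, Finset.sum_empty, Finset.prod_empty] at hZ ⊢
    obtain ⟨r, hr⟩ := Finset.card_pos.1 (by omega : 0 < Z.card)
    rw [← Pr_true (ep (α := Finset V) p1 p2)]
    exact Pr_mono (ep_mem h1 h2) fun ω _ => ⟨{r}, by simpa using hr, by simp, Grown.base r⟩
  | succ T hT ih =>
    intro Z hZ
    rw [Finset.sum_Ico_succ_top hT] at hZ
    rw [Finset.prod_Ico_succ_top hT]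
    obtain ⟨B, hB, hBc⟩ := Finset.exists_subset_card_eq (s := Z) (n := b T) (by omega)
    have h3 := seed_step h1 h2 (Z \ B) B Finset.sdiff_disjoint T
    rw [Finset.sdiff_union_of_subset hB, hBc] at h3
    refine le_trans ?_ h3
    refine mul_le_mul_of_nonneg_right (ih _ ?_) ?_
    · rw [Finset.card_sdiff_of_subset hB]; omega
    · have hq := qv_mem h1 h2 T
      have := pow_le_one₀ (n := b T) (by linarith [hq.2] : 0 ≤ 1 - qv p1 p2 T) (by linarith [hq.1])
      linarith

end JigsawUpper

noncomputable section JigsawStar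
open scoped Classical
set_option linter.unusedSectionVars false
set_option linter.unusedVariables false

variable {n : ℕ}

def star' (x : Fin n) : Finset (PairVertex n) := Finset.univ.filter fun v => x ∈ v.1

lemma mem_star {x : Fin n} {v : PairVertex n} : v ∈ star' x ↔ x ∈ v.1 := by simp [star']

def pr (x y : Fin n) (h : x ≠ y) : PairVertex n := ⟨{x, y}, Finset.card_pair h⟩

lemma pv_eq_pr {v : PairVertex n} {x y : Fin n} (h : x ≠ y) (hx : x ∈ v.1) (hy : y ∈ v.1) :
    v = pr x y h := by
  apply Subtype.ext
  symm
  refine Finset.eq_of_subset_of_card_le ?_ ?_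
  · intro z hz
    simp only [pr, Finset.mem_insert, Finset.mem_singleton] at hz
    rcases hz with rfl | rfl <;> assumption
  · rw [v.2, (pr x y h).2]

lemma star_card (x : Fin n) : (star' x).card = n - 1 := by
  have : star' x = (Finset.univ.erase x).attach.image
      (fun y => pr x y.1 (Finset.ne_of_mem_erase y.2).symm) := by
    ext v
    rw [mem_star, Finset.mem_image]
    constructor
    · intro hx
      obtain ⟨y, hy, hne⟩ := Finset.exists_mem_ne (by rw [v.2]; norm_num) x
      exact ⟨⟨y, by simp [hne]⟩, by simp, (pv_eq_pr hne.symm hx hy).symm⟩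
    · rintro ⟨y, -, rfl⟩
      simp [pr]
  rw [this, Finset.card_image_of_injective, Finset.card_attach, Finset.card_erase_of_mem (by simp),
    Finset.card_univ, Fintype.card_fin]
  intro y z h
  have h' : ({x, y.1} : Finset (Fin n)) = {x, z.1} := congrArg Subtype.val h
  exact Subtype.ext (pair_inj (Finset.ne_of_mem_erase y.2).symm h')

lemma star_edge {x : Fin n} {u v : PairVertex n} (hu : u ∈ star' x) (hv : v ∈ star' x)
    (hne : u ≠ v) : {u, v} ∈ lineGroundEdges n := by
  rw [mem_star] at hu hv
  simp only [lineGroundEdges, Finset.mem_filter, Finset.mem_powersetCard_univ]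
  refine ⟨Finset.card_pair hne, ?_⟩
  intro A hA B hB _
  refine ⟨x, Finset.mem_inter.2 ⟨?_, ?_⟩⟩
  · simp at hA; rcases hA with rfl | rfl <;> assumption
  · simp at hB; rcases hB with rfl | rfl <;> assumption

lemma star_det_disj {x y : Fin n} (h : x ≠ y) : Disjoint (inD (star' x)) (inD (star' y)) := by
  rw [Set.disjoint_left]
  intro i hi hi'
  rw [mem_inD] at hi hi'
  obtain ⟨u, v, huv, e⟩ := Finset.card_eq_two.1 hi.2
  apply huv
  have hu : u ∈ i.1 := by rw [e]; simp
  have hv : v ∈ i.1 := by rw [e]; simp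
  rw [pv_eq_pr h (mem_star.1 (hi.1 hu)) (mem_star.1 (hi'.1 hu)),
    pv_eq_pr h (mem_star.1 (hi.1 hv)) (mem_star.1 (hi'.1 hv))]

lemma join_link {x : Fin n} {ω : Finset (PairVertex n) × Bool → Bool} {c : Bool}
    {w : PairVertex n} {S C C' : Finset (PairVertex n)} (hS : S ⊆ star' x) (hw : w ∈ star' x)
    (hwS : w ∉ S) (hj : Jn c w S ω) (hSC : S ⊆ C) (hwC : w ∈ C') :
    Link (Ecol (lineGroundEdges n) c ω) C' C := by
  obtain ⟨u, hu, h⟩ := hj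
  refine ⟨w, hwC, u, hSC hu, {w, u}, ?_, by simp, by simp⟩
  rw [Ecol, Finset.mem_filter]
  exact ⟨star_edge hw (hS hu) (by rintro rfl; exact hwS hu), h⟩

lemma star_percolates {T : ℕ} (hT : 1 ≤ T) {ω : Finset (PairVertex n) × Bool → Bool}
    (H1 : ∀ x : Fin n, ∀ S ⊆ star' x, T ≤ S.card → S ≠ star' x →
      ∃ w ∈ star' x \ S, Join w S ω)
    (X : Finset (Fin n)) (hX : T ≤ X.card) (H2 : ∀ x ∈ X, Seed (star' x) T ω) :
    JPercolates 1 (Ecol (lineGroundEdges n) true ω) (Ecol (lineGroundEdges n) false ω) := by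
  refine percolates_of fun Q hcov hdis hst => ?_
  have A : ∀ x, ∀ S, Grown ω S → S ⊆ star' x → ∃ C ∈ Q, S ⊆ C := by
    intro x S hg
    induction hg with
    | base r =>
      intro _
      obtain ⟨C, hC, hr⟩ := hcov r
      exact ⟨C, hC, by simpa using hr⟩
    | step S w _ hw hj ih =>
      intro hS
      have hSZ := (Finset.subset_insert w S).trans hS
      obtain ⟨C, hC, hSC⟩ := ih hSZ
      obtain ⟨C', hC', hw'⟩ := hcov w
      have hwx := hS (Finset.mem_insert_self w S)
      have := hst C' hC' C hC (join_link hSZ hwx hw hj.1 hSC hw') (join_link hSZ hwx hw hj.2 hSC hw')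
      subst this
      exact ⟨C', hC, Finset.insert_subset hw' hSC⟩
  have B : ∀ x, ∀ C ∈ Q, T ≤ (C ∩ star' x).card → star' x ⊆ C := by
    intro x C hC hc
    by_contra hne
    obtain ⟨w, hw, hj⟩ := H1 x (C ∩ star' x) Finset.inter_subset_right hc (by
      intro h; exact hne (by rw [← h]; exact Finset.inter_subset_left))
    rw [Finset.mem_sdiff] at hw
    obtain ⟨C', hC', hw'⟩ := hcov w
    have := hst C' hC' C hC
      (join_link Finset.inter_subset_right hw.1 hw.2 hj.1 Finset.inter_subset_left hw')
      (join_link Finset.inter_subset_right hw.1 hw.2 hj.2 Finset.inter_subset_left hw')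
    subst this
    exact hw.2 (Finset.mem_inter.2 ⟨hw', hw.1⟩)
  have A2 : ∀ x ∈ X, ∃ C ∈ Q, star' x ⊆ C := by
    intro x hx
    obtain ⟨S, hS, hc, hg⟩ := H2 x hx
    obtain ⟨C, hC, hSC⟩ := A x S hg hS
    refine ⟨C, hC, B x C hC ?_⟩
    rw [← hc]
    exact Finset.card_le_card (Finset.subset_inter hSC hS)
  obtain ⟨x0, hx0⟩ := Finset.card_pos.1 (by omega : 0 < X.card)
  obtain ⟨C, hC, hxC⟩ := A2 x0 hx0
  have A3 : ∀ x ∈ X, star' x ⊆ C := by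
    intro x hx
    by_cases h : x = x0
    · rw [h]; exact hxC
    · obtain ⟨C', hC', h'⟩ := A2 x hx
      have := hdis C' hC' C hC (pr x x0 h) (h' (mem_star.2 (by simp [pr])))
        (hxC (mem_star.2 (by simp [pr])))
      rw [← this]; exact h'
  have A4 : ∀ y, star' y ⊆ C := by
    intro y
    by_cases hy : y ∈ X
    · exact A3 y hy
    · refine B y C hC (hX.trans ?_)
      have hxy : ∀ x : {x // x ∈ X}, x.1 ≠ y := fun x h => hy (h ▸ x.2)
      rw [← Finset.card_attach (s := X)]
      refine Finset.card_le_card_of_injOn (fun x => pr y x.1 (hxy x).symm) ?_ ?_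
      · intro x _
        simp only [Finset.coe_inter, Set.mem_inter_iff, Finset.mem_coe]
        exact ⟨A3 x.1 x.2 (mem_star.2 (by simp [pr])), mem_star.2 (by simp [pr])⟩
      · intro x _ z _ h
        have h' : ({y, x.1} : Finset (Fin n)) = {y, z.1} := congrArg Subtype.val h
        exact Subtype.ext (pair_inj (hxy x).symm h')
  have : C = Finset.univ := by
    ext v
    simp only [Finset.mem_univ, iff_true]
    obtain ⟨x, hx⟩ := Finset.card_pos.1 (by rw [v.2]; norm_num : 0 < v.1.card)
    exact A4 x (mem_star.2 hx)
  rw [← this]; exact hC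

end JigsawStar


noncomputable section JigsawLower
open scoped Classical
set_option linter.unusedSectionVars false
set_option linter.unusedVariables false

lemma term_bound (n : ℕ) (L x : ℝ) (hL : L = Real.log n) (hL2 : 2 ≤ L) (hn : 0 < (n : ℝ)) (hx : 0 ≤ x)
    (hx2 : x ≤ 1 / (2 ^ 30 * (n : ℝ) * L)) (r : ℕ) (hr : L ≤ (r + 1 : ℕ)) (hr2 : ((r + 1 : ℕ) : ℝ) ≤ 4 * L) :
    ((n : ℝ) ^ 2 * (2 * n) ^ r) * (((r + 1 : ℕ) : ℝ) ^ (r + 1)) ^ 2 * x ^ r ≤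
      (Real.exp 16 / (n : ℝ) ^ 12) * ((r + 1).factorial : ℝ) := by
  set s : ℝ := ((r + 1 : ℕ) : ℝ) with hs
  have hs0 : 0 < s := by rw [hs]; positivity
  have hfac : (0 : ℝ) < ((r + 1).factorial : ℝ) := by positivity
  have e1 : s ^ (r + 1) ≤ Real.exp s * ((r + 1).factorial : ℝ) := by
    have := Real.pow_div_factorial_le_exp s hs0.le (r + 1)
    rwa [div_le_iff₀ hfac] at this
  have e2 : 2 * n * s * x ≤ Real.exp (-16) := by
    have h1 : 2 * n * s * x ≤ 2 * n * (4 * L) * (1 / (2 ^ 30 * (n : ℝ) * L)) := by gcongr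
    have h2 : 2 * n * (4 * L) * (1 / (2 ^ 30 * (n : ℝ) * L)) = 1 / 2 ^ 27 := by
      have : L ≠ 0 := by linarith
      field_simp; norm_num
    have h3 : Real.exp 16 ≤ 2 ^ 27 := by
      have := Real.exp_one_lt_d9
      have h4 : Real.exp 16 = Real.exp 1 ^ 16 := by rw [← Real.exp_nat_mul]; norm_num
      rw [h4]
      calc Real.exp 1 ^ 16 ≤ 2.72 ^ 16 := by
            gcongr; linarith
        _ ≤ 2 ^ 27 := by norm_num
    rw [h2] at h1
    rw [Real.exp_neg]
    refine h1.trans ?_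
    rw [one_div]
    exact inv_anti₀ (Real.exp_pos _) h3
  have e3 : (2 * n * s * x) ^ r ≤ Real.exp (-16 * r) := by
    calc (2 * n * s * x) ^ r ≤ Real.exp (-16) ^ r := by gcongr
      _ = _ := by rw [← Real.exp_nat_mul]; ring_nf
  have e4 : s ≤ Real.exp s := by linarith [Real.add_one_le_exp s]
  have hn2 : (n : ℝ) = Real.exp L := by rw [hL, Real.exp_log hn]
  calc ((n : ℝ) ^ 2 * (2 * n) ^ r) * (s ^ (r + 1)) ^ 2 * x ^ r
      = (n : ℝ) ^ 2 * (2 * n * s * x) ^ r * s * s ^ (r + 1) := by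
        rw [mul_pow (2 * n * s) x, mul_pow (2 * (n:ℝ)) s]; ring
    _ ≤ (n : ℝ) ^ 2 * Real.exp (-16 * r) * Real.exp s * (Real.exp s * ((r + 1).factorial : ℝ)) := by
        gcongr
    _ = ((n : ℝ) ^ 2 * Real.exp (-16 * r) * Real.exp s * Real.exp s) * ((r + 1).factorial : ℝ) := by ring
    _ ≤ _ := by
        gcongr
        rw [hn2, ← Real.exp_nat_mul, ← Real.exp_nat_mul, ← Real.exp_add, ← Real.exp_add,
          ← Real.exp_add, ← Real.exp_sub]
        apply Real.exp_le_exp.2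
        have : s = r + 1 := by rw [hs]; push_cast; ring
        rw [this] at hr ⊢
        push_cast
        linarith

def pval {n : ℕ} (v : PairVertex n) : Finset (Fin n) := v.1

lemma nbr_count (n : ℕ) (u : PairVertex n) :
    (Finset.univ.filter fun v => v ≠ u ∧ {u, v} ∈ lineGroundEdges n).card ≤ 2 * n := by
  have h : ((Finset.univ.filter fun v : PairVertex n => v ≠ u ∧ {u, v} ∈ lineGroundEdges n).image
      pval) ⊆ (u.1 ×ˢ (Finset.univ : Finset (Fin n))).image fun z => {z.1, z.2} := by
    intro A hA
    obtain ⟨v, hv, rfl⟩ := Finset.mem_image.1 hA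
    rw [Finset.mem_filter] at hv
    obtain ⟨-, hne, he⟩ := hv
    simp only [lineGroundEdges, Finset.mem_filter] at he
    obtain ⟨a, ha⟩ := he.2 u (by simp) v (by simp) hne.symm
    rw [Finset.mem_inter] at ha
    obtain ⟨y, hy, hya⟩ := Finset.exists_mem_ne (by rw [v.2]; norm_num) a
    refine Finset.mem_image.2 ⟨(a, y), by simp [ha.1], ?_⟩
    exact (congrArg pval (pv_eq_pr hya.symm ha.2 hy)).symm
  have h1 := Finset.card_le_card h
  rw [Finset.card_image_of_injective _ (f := pval) (fun a b h => Subtype.ext h)] at h1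
  refine h1.trans (Finset.card_image_le.trans ?_)
  rw [Finset.card_product, u.2]; simp

lemma card_pv (n : ℕ) : Fintype.card (PairVertex n) = n.choose 2 := by
  have := Fintype.card_finset_len (α := Fin n) 2
  rw [Fintype.card_fin] at this
  rw [← this]
  exact Fintype.card_congr (Equiv.refl _)

lemma part1_fin (n : ℕ) {p1 p2 : ℝ} (h1 : 0 ≤ p1 ∧ p1 ≤ 1) (h2 : 0 ≤ p2 ∧ p2 ≤ 1)
    (hL2 : 2 ≤ Real.log n) (hn : 10 ≤ n)
    (hx : p1 * p2 ≤ 1 / (2 ^ 30 * (n : ℝ) * Real.log n)) :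
    Pr (ep (α := Finset (PairVertex n)) p1 p2) (fun ω =>
      JPercolates 1 (Ecol (lineGroundEdges n) true ω) (Ecol (lineGroundEdges n) false ω)) ≤
      Real.exp 16 / n := by
  set L := Real.log n with hL
  set k := ⌈L⌉₊ with hk
  have hn0 : (0 : ℝ) < n := by positivity
  have hkL : L ≤ k := Nat.le_ceil L
  have hkL2 : (k : ℝ) < L + 1 := Nat.ceil_lt_add_one (by linarith)
  have hk2 : 2 ≤ k := by
    have : (2 : ℝ) ≤ k := hL2.trans hkL
    exact_mod_cast this
  have hLn : L ≤ n - 1 := Real.log_le_sub_one_of_pos hn0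
  have hkn : k + 1 ≤ n + 1 := by
    have : (k : ℝ) < n := by linarith
    have : k < n := by exact_mod_cast this
    omega
  have hkn' : k < n := by
    have : (k : ℝ) < n := by linarith
    exact_mod_cast this
  have hN : n ≤ Fintype.card (PairVertex n) := by
    rw [card_pv, Nat.choose_two_right, Nat.le_div_iff_mul_le (by norm_num)]
    exact Nat.mul_le_mul_left _ (by omega)
  have hN2 : ((Fintype.card (PairVertex n) : ℕ) : ℝ) ≤ (n : ℝ) ^ 2 := by
    rw [card_pv]; exact_mod_cast Nat.choose_le_pow n 2
  have hp := ep_mem (α := Finset (PairVertex n)) h1 h2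
  have step1 : Pr (ep (α := Finset (PairVertex n)) p1 p2) (fun ω =>
      JPercolates 1 (Ecol (lineGroundEdges n) true ω) (Ecol (lineGroundEdges n) false ω)) ≤
      Pr (ep (α := Finset (PairVertex n)) p1 p2) (fun ω => ∃ s ∈ Finset.Icc k (2 * k),
        ∃ S : Finset (PairVertex n), S.card = s ∧ ConnOn (Ecol (lineGroundEdges n) true ω) S ∧
          ConnOn (Ecol (lineGroundEdges n) false ω) S) := by
    refine Pr_mono hp fun ω h => ?_
    obtain ⟨S, hS1, hS2, hc⟩ := medium h hk2 (hkn'.le.trans hN)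
    exact ⟨S.card, Finset.mem_Icc.2 ⟨hS1, hS2⟩, S, rfl, hc⟩
  refine step1.trans ((Pr_exists_le hp _ _).trans ?_)
  have hterm : ∀ s ∈ Finset.Icc k (2 * k), Pr (ep (α := Finset (PairVertex n)) p1 p2) (fun ω =>
        ∃ S : Finset (PairVertex n), S.card = s ∧ ConnOn (Ecol (lineGroundEdges n) true ω) S ∧
          ConnOn (Ecol (lineGroundEdges n) false ω) S) ≤ Real.exp 16 / (n : ℝ) ^ 12 := by
    intro s hs
    rw [Finset.mem_Icc] at hs
    obtain ⟨r, rfl⟩ : ∃ r, s = r + 1 := ⟨s - 1, by omega⟩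
    have hb := part1_bound (lineGroundEdges n) (by
      intro e he
      simp only [lineGroundEdges, Finset.mem_filter, Finset.mem_powersetCard_univ] at he
      exact he.1) (2 * n) (by omega) (fun u => by convert nbr_count n u) r h1 h2
    have hfac : (0 : ℝ) < ((r + 1).factorial : ℝ) := by positivity
    have hx0 : 0 ≤ p1 * p2 := mul_nonneg h1.1 h2.1
    have ht := term_bound n L (p1 * p2) hL hL2 hn0 hx0 hx r
      (hkL.trans (by exact_mod_cast hs.1)) (by
        have : ((r + 1 : ℕ) : ℝ) ≤ ((2 * k : ℕ) : ℝ) := by exact_mod_cast hs.2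
        push_cast at this ⊢; linarith)
    refine le_of_mul_le_mul_right (hb.trans (le_trans ?_ ht)) hfac
    have h5 : ((Fintype.card (PairVertex n) * (2 * n) ^ r : ℕ) : ℝ) ≤ (n : ℝ) ^ 2 * (2 * n) ^ r := by
      push_cast; gcongr
    gcongr
  refine (Finset.sum_le_sum hterm).trans ?_
  rw [Finset.sum_const, Nat.card_Icc, nsmul_eq_mul]
  have : ((2 * k + 1 - k : ℕ) : ℝ) ≤ n := by
    have : 2 * k + 1 - k ≤ n := by omega
    exact_mod_cast this
  have hn1 : (1 : ℝ) ≤ n := by exact_mod_cast (by omega : 1 ≤ n)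
  calc ((2 * k + 1 - k : ℕ) : ℝ) * (Real.exp 16 / (n : ℝ) ^ 12) ≤ n * (Real.exp 16 / (n : ℝ) ^ 12) := by gcongr
    _ = Real.exp 16 / (n : ℝ) ^ 11 := by field_simp
    _ ≤ _ := by
      gcongr
      exact le_self_pow₀ hn1 (by norm_num)

lemma part1_main (p1 p2 : ℕ → ℝ) (h1 : ∀ n, 0 ≤ p1 n ∧ p1 n ≤ 1) (h2 : ∀ n, 0 ≤ p2 n ∧ p2 n ≤ 1)
    (hx : ∀ᶠ n : ℕ in atTop, p1 n * p2 n ≤ 1 / (2 ^ 30 * (n : ℝ) * Real.log n)) :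
    Tendsto (fun n : ℕ => probDouble (lineGroundEdges n) (p1 n) (p2 n)
              fun E1 E2 => ¬ JPercolates 1 E1 E2) atTop (nhds 1) := by
  have hlog : ∀ᶠ n : ℕ in atTop, 2 ≤ Real.log n :=
    (Real.tendsto_log_atTop.comp tendsto_natCast_atTop_atTop).eventually_ge_atTop 2
  have hlim : Tendsto (fun n : ℕ => 1 - Real.exp 16 / (n : ℝ)) atTop (nhds 1) := by
    have := (tendsto_const_div_atTop_nhds_zero_nat (Real.exp 16)).const_sub 1
    simpa using this
  refine tendsto_of_tendsto_of_tendsto_of_le_of_le' hlim tendsto_const_nhds ?_ ?_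
  · filter_upwards [hlog, hx, eventually_ge_atTop 10] with n hn hxn h10
    rw [probDouble_eq, Pr_not]
    have := part1_fin n (h1 n) (h2 n) hn h10 hxn
    linarith
  · filter_upwards with n
    rw [probDouble_eq]
    exact Pr_le_one (ep_mem (h1 n) (h2 n)) _

end JigsawLower


noncomputable section JigsawAnalysis
set_option linter.unusedSectionVars false
set_option linter.unusedVariables false

structure Hyp2 (n : ℕ) (p1 p2 L : ℝ) : Prop where
  hL : L = Real.log n
  h1 : 0 ≤ p1 ∧ p1 ≤ 1
  h2 : 0 ≤ p2 ∧ p2 ≤ 1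
  L100 : 100 ≤ L
  big : 2 ^ 50 * L ^ 8 ≤ n
  hP : 2 ^ 40 / (n * L) ≤ p1 * p2
  m1 : 2 ^ 40 * L / n ≤ p1
  m2 : 2 ^ 40 * L / n ≤ p2

lemma one_sub_pow_exp {p : ℝ} (hp : 0 ≤ p ∧ p ≤ 1) (t : ℕ) : (1 - p) ^ t ≤ Real.exp (-(t * p)) := by
  have h := Real.one_sub_le_exp_neg p
  calc (1 - p) ^ t ≤ Real.exp (-p) ^ t := pow_le_pow_left₀ (by linarith [hp.2]) h t
    _ = _ := by rw [← Real.exp_nat_mul]; ring_nf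

lemma one_sub_exp_ge {a : ℝ} (ha : 0 ≤ a) : a / (1 + a) ≤ 1 - Real.exp (-a) := by
  have h := Real.add_one_le_exp a
  rw [Real.exp_neg]
  have : (Real.exp a)⁻¹ ≤ (1 + a)⁻¹ := inv_anti₀ (by linarith) (by linarith)
  have e : a / (1 + a) = 1 - (1 + a)⁻¹ := by field_simp; ring
  rw [e]; linarith

lemma half_min {p : ℝ} (hp : 0 ≤ p ∧ p ≤ 1) (t : ℕ) : min 1 (t * p) / 2 ≤ 1 - (1 - p) ^ t := by
  have ha : 0 ≤ t * p := mul_nonneg (by positivity) hp.1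
  have h1 := one_sub_exp_ge ha
  have h2 := one_sub_pow_exp hp t
  have h3 : min 1 (t * p) / 2 ≤ t * p / (1 + t * p) := by
    rw [div_le_div_iff₀ (by norm_num) (by linarith)]
    rcases le_total 1 (t * p) with h | h
    · rw [min_eq_left h]; linarith
    · rw [min_eq_right h]; nlinarith
  linarith

lemma qv_lower {n : ℕ} {p1 p2 L : ℝ} (H : Hyp2 n p1 p2 L) (t : ℕ) (y : ℝ) (y1 : y ≤ 1)
    (y2 : y ≤ t ^ 2 * (2 ^ 40 / (n * L))) (y3 : y ≤ t * (2 ^ 40 * L / n)) : y / 4 ≤ qv p1 p2 t := by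
  have a1 := half_min H.h1 t
  have a2 := half_min H.h2 t
  have t0 : (0 : ℝ) ≤ t := by positivity
  have b1 : 0 ≤ t * p1 := mul_nonneg t0 H.h1.1
  have b2 : 0 ≤ t * p2 := mul_nonneg t0 H.h2.1
  have c1 : t * (2 ^ 40 * L / n) ≤ t * p1 := mul_le_mul_of_nonneg_left H.m1 t0
  have c2 : t * (2 ^ 40 * L / n) ≤ t * p2 := mul_le_mul_of_nonneg_left H.m2 t0
  have c3 : t ^ 2 * (2 ^ 40 / (n * L)) ≤ (t * p1) * (t * p2) := by
    calc _ ≤ (t : ℝ) ^ 2 * (p1 * p2) := mul_le_mul_of_nonneg_left H.hP (by positivity)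
      _ = _ := by ring
  have h0 : y ≤ min 1 (t * p1) * min 1 (t * p2) := by
    rcases le_total 1 (t * p1) with h | h <;> rcases le_total 1 (t * p2) with h' | h' <;>
      simp only [h, h', min_eq_left, min_eq_right] <;> linarith
  have m1 : 0 ≤ min 1 (t * p1) := le_min zero_le_one b1
  have m2 : 0 ≤ min 1 (t * p2) := le_min zero_le_one b2
  calc y / 4 ≤ (min 1 (t * p1) / 2) * (min 1 (t * p2) / 2) := by linarith
    _ ≤ _ := by rw [qv]; exact mul_le_mul a1 a2 (by linarith) (by linarith)

lemma Hyp2.npos {n : ℕ} {p1 p2 L : ℝ} (H : Hyp2 n p1 p2 L) : (0 : ℝ) < n := by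
  have := H.L100; have := H.big
  have : 0 < 2 ^ 50 * L ^ 8 := by positivity
  linarith

lemma Hyp2.pw {n : ℕ} {p1 p2 L : ℝ} (H : Hyp2 n p1 p2 L) (k : ℕ) (hk : k ≤ 8) : 2 ^ 50 * L ^ k ≤ n := by
  have h := H.L100
  have : L ^ k ≤ L ^ 8 := pow_le_pow_right₀ (by linarith) hk
  linarith [H.big]

lemma qv_seed {n : ℕ} {p1 p2 L : ℝ} (H : Hyp2 n p1 p2 L) (t : ℕ) (ht : (t : ℝ) ≤ L ^ 2) :
    2 ^ 40 * t ^ 2 / (4 * n * L) ≤ qv p1 p2 t := by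
  have hn := H.npos
  have hL := H.L100
  have hL0 : 0 < L := by linarith
  have t0 : (0 : ℝ) ≤ t := by positivity
  have := qv_lower H t (t ^ 2 * (2 ^ 40 / (n * L))) ?_ le_rfl ?_
  · refine le_trans (le_of_eq ?_) this
    field_simp
  · rw [← mul_div_assoc, div_le_one (by positivity)]
    have h3 := H.pw 3 (by norm_num)
    have : (t : ℝ) ^ 2 ≤ (L ^ 2) ^ 2 := by gcongr
    have : (2 ^ 50 * L ^ 3) * L ≤ n * L := by gcongr
    have : 0 ≤ L ^ 4 := by positivity
    nlinarith
  · have e : t * (2 ^ 40 * L / n) - t ^ 2 * (2 ^ 40 / (n * L)) = t * 2 ^ 40 / (n * L) * (L ^ 2 - t) := by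
      field_simp
    have : 0 ≤ t * 2 ^ 40 / (n * L) * (L ^ 2 - t) := mul_nonneg (by positivity) (by linarith)
    linarith

lemma fac_ge {q x : ℝ} (hq : 0 ≤ q ∧ q ≤ 1) (b : ℕ) (h : x ≤ b * q) :
    1 - Real.exp (-x) ≤ 1 - (1 - q) ^ b := by
  have h1 := one_sub_pow_exp hq b
  have h2 : Real.exp (-(b * q)) ≤ Real.exp (-x) := Real.exp_le_exp.2 (by linarith)
  linarith

/-- seed factor with weight w -/
lemma seed_fac {n : ℕ} {p1 p2 L : ℝ} (H : Hyp2 n p1 p2 L) (t : ℕ) (ht : (t : ℝ) ≤ L ^ 2) (w : ℝ)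
    (hw : 2 ≤ n * w) :
    1 - Real.exp (-(2 ^ 37 * t ^ 2 * w / L)) ≤ 1 - (1 - qv p1 p2 t) ^ ⌊n * w⌋₊ := by
  have hn := H.npos
  have hL := H.L100
  have hL0 : 0 < L := by linarith
  refine fac_ge (qv_mem H.h1 H.h2 t) _ ?_
  have h1 : n * w / 2 ≤ (⌊n * w⌋₊ : ℝ) := by
    have := Nat.lt_floor_add_one (n * w); linarith
  calc 2 ^ 37 * t ^ 2 * w / L = (n * w / 2) * (2 ^ 40 * t ^ 2 / (4 * n * L)) := by
        field_simp; ring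
    _ ≤ _ := by
        apply mul_le_mul h1 (qv_seed H t ht) (by positivity) (by positivity)

lemma fac_small {x z : ℝ} (hz : 0 < z) (hx : 1 / z ^ 4 ≤ x) : Real.exp (-(4 * z)) ≤ 1 - Real.exp (-x) := by
  have hx0 : 0 < x := lt_of_lt_of_le (by positivity) hx
  refine le_trans ?_ (one_sub_exp_ge hx0.le)
  have h1 : 1 + z ^ 4 ≤ Real.exp (4 * z) := by
    have := Real.add_one_le_exp z
    calc 1 + z ^ 4 ≤ (z + 1) ^ 4 := by nlinarith [pow_pos hz 2, pow_pos hz 3]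
      _ ≤ Real.exp z ^ 4 := by gcongr
      _ = _ := by rw [← Real.exp_nat_mul]; norm_num
  rw [Real.exp_neg]
  calc (Real.exp (4 * z))⁻¹ ≤ (1 + z ^ 4)⁻¹ := inv_anti₀ (by positivity) h1
    _ ≤ _ := by
      rw [inv_eq_one_div, div_le_div_iff₀ (by positivity) (by positivity)]
      rw [div_le_iff₀ (by positivity)] at hx
      linarith

lemma fac_large {x y : ℝ} (hx0 : 0 < x) (hx : 1 ≤ x) (hy : 1 ≤ y * x ^ 4) :
    Real.exp (-(48 * y)) ≤ 1 - Real.exp (-x) := by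
  have h1 : x ^ 4 / 24 ≤ Real.exp x := by
    have := Real.pow_div_factorial_le_exp x hx0.le 4
    simpa [Nat.factorial] using this
  have h2 : Real.exp (-x) ≤ 24 * y := by
    rw [Real.exp_neg, inv_le_iff_one_le_mul₀ (Real.exp_pos x)]
    have hy0 : 0 ≤ y := by
      by_contra h
      push Not at h
      have : 0 < x ^ 4 := by positivity
      nlinarith
    calc 1 ≤ y * x ^ 4 := hy
      _ = 24 * y * (x ^ 4 / 24) := by ring
      _ ≤ _ := by gcongr
  have h3 : Real.exp (-x) ≤ 1 / 2 := by
    rw [Real.exp_neg, one_div]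
    exact inv_anti₀ (by norm_num) (by linarith [Real.add_one_le_exp x])
  set e := Real.exp (-x) with he
  have e0 : 0 < e := Real.exp_pos _
  have h4 : Real.exp (-(2 * e)) ≤ 1 - e := by
    rw [Real.exp_neg]
    have := Real.add_one_le_exp (2 * e)
    calc (Real.exp (2 * e))⁻¹ ≤ (2 * e + 1)⁻¹ := inv_anti₀ (by positivity) this
      _ ≤ _ := by
        rw [inv_le_iff_one_le_mul₀ (by positivity)]
        nlinarith
  refine le_trans (Real.exp_le_exp.2 ?_) h4
  linarith

lemma sum_inv_sqrt (m : ℕ) : ∑ t ∈ Finset.range m, 1 / √((t : ℝ) + 1) ≤ 2 * √(m : ℝ) := by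
  induction m with
  | zero => simp
  | succ m ih =>
    rw [Finset.sum_range_succ]
    push_cast
    set a := √((m : ℝ) + 1) with ha
    have a0 : 0 < a := Real.sqrt_pos.2 (by positivity)
    have a2 : a ^ 2 = m + 1 := Real.sq_sqrt (by positivity)
    have b0 : 0 ≤ √(m : ℝ) := Real.sqrt_nonneg _
    have b2 : √(m : ℝ) ^ 2 = m := Real.sq_sqrt (by positivity)
    set b := √(m : ℝ)
    have : 1 / a ≤ 2 * a - 2 * b := by
      rw [div_le_iff₀ a0]
      nlinarith [sq_nonneg (a - b)]
    linarith

lemma sum_inv_sq (l T : ℕ) (hl : 2 ≤ l) (hT : l ≤ T) :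
    ∑ t ∈ Finset.Ico l T, 1 / (t : ℝ) ^ 2 ≤ 1 / ((l : ℝ) - 1) - 1 / ((T : ℝ) - 1) := by
  induction T, hT using Nat.le_induction with
  | base => simp
  | succ T hT ih =>
    rw [Finset.sum_Ico_succ_top hT]
    have hT2 : (2 : ℝ) ≤ T := by exact_mod_cast hl.trans hT
    have : 1 / (T : ℝ) ^ 2 ≤ 1 / ((T : ℝ) - 1) - 1 / (T : ℝ) := by
      rw [div_sub_div _ _ (by linarith) (by linarith), div_le_div_iff₀ (by positivity) (by nlinarith)]
      nlinarith
    push_cast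
    rw [add_sub_cancel_right]
    linarith

end JigsawAnalysis


noncomputable section JigsawSeedProb
set_option linter.unusedSectionVars false
set_option linter.unusedVariables false

def wgt (l t : ℕ) : ℝ := if t < l then 1 / (8 * l) else √(l : ℝ) / 4 * (1 / √(t : ℝ) - 1 / √((t : ℝ) + 1))

lemma wgt_sum (l T : ℕ) (hl : 2 ≤ l) (hT : l ≤ T) : ∑ t ∈ Finset.Ico 1 T, wgt l t ≤ 3 / 8 := by
  rw [← Finset.sum_Ico_consecutive _ (by omega : 1 ≤ l) hT]
  have h1 : ∑ t ∈ Finset.Ico 1 l, wgt l t ≤ 1 / 8 := by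
    have : ∑ t ∈ Finset.Ico 1 l, wgt l t = ∑ t ∈ Finset.Ico 1 l, 1 / (8 * (l : ℝ)) := by
      refine Finset.sum_congr rfl fun t ht => ?_
      rw [wgt, if_pos (Finset.mem_Ico.1 ht).2]
    rw [this, Finset.sum_const, Nat.card_Ico, nsmul_eq_mul]
    have h2 : ((l - 1 : ℕ) : ℝ) ≤ l := by exact_mod_cast Nat.sub_le l 1
    have h3 : (0 : ℝ) < l := by exact_mod_cast (by omega : 0 < l)
    calc ((l - 1 : ℕ) : ℝ) * (1 / (8 * (l : ℝ))) ≤ l * (1 / (8 * (l : ℝ))) := by gcongr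
      _ = _ := by field_simp
  have h2 : ∑ t ∈ Finset.Ico l T, wgt l t = √(l : ℝ) / 4 * (1 / √(l : ℝ) - 1 / √(T : ℝ)) := by
    induction T, hT using Nat.le_induction with
    | base => simp
    | succ T hT ih =>
      rw [Finset.sum_Ico_succ_top hT, ih, wgt, if_neg (by omega)]
      push_cast; ring
  have h3 : 0 < √(l : ℝ) := Real.sqrt_pos.2 (by exact_mod_cast (by omega : 0 < l))
  have h4 : √(l : ℝ) / 4 * (1 / √(l : ℝ) - 1 / √(T : ℝ)) ≤ 1 / 4 := by
    have : √(l : ℝ) / 4 * (1 / √(l : ℝ) - 1 / √(T : ℝ)) = 1 / 4 - √(l : ℝ) / 4 * (1 / √(T : ℝ)) := by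
      field_simp
    rw [this]
    have : 0 ≤ √(l : ℝ) / 4 * (1 / √(T : ℝ)) := by positivity
    linarith
  linarith

lemma prod_exp_le {s : Finset ℕ} {f g : ℕ → ℝ} {B : ℝ} (h : ∀ t ∈ s, Real.exp (-g t) ≤ f t)
    (hB : ∑ t ∈ s, g t ≤ B) : Real.exp (-B) ≤ ∏ t ∈ s, f t := by
  calc Real.exp (-B) ≤ Real.exp (∑ t ∈ s, -g t) := by
        apply Real.exp_le_exp.2; rw [Finset.sum_neg_distrib]; linarith
    _ = ∏ t ∈ s, Real.exp (-g t) := Real.exp_sum _ _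
    _ ≤ _ := Finset.prod_le_prod (fun _ _ => (Real.exp_pos _).le) h

lemma wgt_large (l t : ℕ) (hl : 1 ≤ l) (h : l ≤ t) : √(l : ℝ) / (24 * t * √(t : ℝ)) ≤ wgt l t := by
  rw [wgt, if_neg (by omega)]
  have t1 : (1 : ℝ) ≤ t := by exact_mod_cast hl.trans h
  set a := √(t : ℝ) with ha
  set b := √((t : ℝ) + 1) with hb
  have a2 : a ^ 2 = t := Real.sq_sqrt (by positivity)
  have b2 : b ^ 2 = t + 1 := Real.sq_sqrt (by positivity)
  have a1 : 1 ≤ a := by rw [ha]; exact Real.one_le_sqrt.2 t1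
  have a0 : 0 < a := by linarith
  have b0 : 0 < b := Real.sqrt_pos.2 (by positivity)
  have hba : b ≤ 3 / 2 * a := by nlinarith
  have key : 1 / (6 * t * a) ≤ 1 / a - 1 / b := by
    have e : 1 / a - 1 / b = 1 / (a * b * (a + b)) := by
      rw [div_sub_div _ _ a0.ne' b0.ne', div_eq_div_iff (by positivity) (by positivity)]
      linear_combination a * b * (b2 - a2)
    rw [e]
    apply one_div_le_one_div_of_le (by positivity)
    rw [← a2]
    have : b * (a + b) ≤ (3 / 2 * a) * (a + 3 / 2 * a) := by gcongr
    nlinarith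
  calc √(l : ℝ) / (24 * t * a) = √(l : ℝ) / 4 * (1 / (6 * t * a)) := by field_simp; norm_num
    _ ≤ _ := by gcongr

lemma seed_low {n : ℕ} {p1 p2 L : ℝ} (H : Hyp2 n p1 p2 L) :
    Real.exp (-(L / 2)) ≤
      ∏ t ∈ Finset.Ico 1 ⌈L ^ 2⌉₊, (1 - (1 - qv p1 p2 t) ^ ⌊n * wgt ⌈L⌉₊ t⌋₊) := by
  have hn := H.npos
  have hL := H.L100
  have hL0 : 0 < L := by linarith
  set l := ⌈L⌉₊ with hl
  set T := ⌈L ^ 2⌉₊ with hT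
  have hLl : L ≤ l := Nat.le_ceil L
  have hlL : (l : ℝ) < L + 1 := Nat.ceil_lt_add_one hL0.le
  have hl2 : 2 ≤ l := by
    have : (2 : ℝ) ≤ l := by linarith
    exact_mod_cast this
  have hlT : l ≤ T := Nat.ceil_mono (by nlinarith)
  rw [← Finset.prod_Ico_consecutive _ (by omega : 1 ≤ l) hlT]
  have P1 : Real.exp (-(L / 4)) ≤ ∏ t ∈ Finset.Ico 1 l, (1 - (1 - qv p1 p2 t) ^ ⌊n * wgt l t⌋₊) := by
    refine prod_exp_le (g := fun t => 4 * (√L / √(t : ℝ) / 2 ^ 8)) ?_ ?_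
    · intro t ht
      rw [Finset.mem_Ico] at ht
      have htL : (t : ℝ) < L := Nat.lt_ceil.1 ht.2
      have t1 : (1 : ℝ) ≤ t := by exact_mod_cast ht.1
      have t0 : (0 : ℝ) < t := by linarith
      have hw : wgt l t = 1 / (8 * l) := by rw [wgt, if_pos ht.2]
      have l0 : (0 : ℝ) < l := by linarith
      refine le_trans ?_ (seed_fac H t (by nlinarith) (wgt l t) ?_)
      · refine fac_small (by positivity) ?_
        have e : (√L / √(t : ℝ) / 2 ^ 8) ^ 4 = L ^ 2 / t ^ 2 / 2 ^ 32 := by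
          have s1 : √L ^ 4 = L ^ 2 := by
            rw [show 4 = 2 * 2 by norm_num, pow_mul, Real.sq_sqrt hL0.le]
          have s2 : √(t : ℝ) ^ 4 = t ^ 2 := by
            rw [show 4 = 2 * 2 by norm_num, pow_mul, Real.sq_sqrt t0.le]
          rw [div_pow, div_pow, s1, s2]; norm_num
        rw [e, hw]
        have : 1 / (8 * (2 * L)) ≤ 1 / (8 * (l : ℝ)) := by
          apply one_div_le_one_div_of_le (by positivity); linarith
        calc 1 / (L ^ 2 / t ^ 2 / 2 ^ 32) = 2 ^ 36 * t ^ 2 * (1 / (8 * (2 * L))) / L := by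
              field_simp; norm_num
          _ ≤ 2 ^ 37 * t ^ 2 * (1 / (8 * (l : ℝ))) / L := by
              gcongr <;> norm_num
      · rw [hw]
        have h3 := H.pw 1 (by norm_num)
        rw [← mul_div_assoc, mul_one, le_div_iff₀ (by positivity)]
        linarith
    · have e : ∑ t ∈ Finset.Ico 1 l, 4 * (√L / √(t : ℝ) / 2 ^ 8) =
          √L / 64 * ∑ t ∈ Finset.range (l - 1), 1 / √((t : ℝ) + 1) := by
        rw [Finset.sum_Ico_eq_sum_range, Finset.mul_sum]
        refine Finset.sum_congr rfl fun t _ => ?_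
        push_cast
        rw [add_comm (1 : ℝ)]; ring
      rw [e]
      have h3 := sum_inv_sqrt (l - 1)
      have h4 : √((l - 1 : ℕ) : ℝ) ≤ √L := by
        apply Real.sqrt_le_sqrt
        rw [Nat.cast_sub (by omega)]; push_cast; linarith
      calc √L / 64 * ∑ t ∈ Finset.range (l - 1), 1 / √((t : ℝ) + 1) ≤ √L / 64 * (2 * √L) := by
            gcongr; linarith
        _ = √L ^ 2 / 32 := by ring
        _ = L / 32 := by rw [Real.sq_sqrt hL0.le]
        _ ≤ _ := by linarith
  have P2 : Real.exp (-(L / 4)) ≤ ∏ t ∈ Finset.Ico l T, (1 - (1 - qv p1 p2 t) ^ ⌊n * wgt l t⌋₊) := by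
    refine prod_exp_le (g := fun t => 48 * (L ^ 2 / (2 ^ 10 * (t : ℝ) ^ 2))) ?_ ?_
    · intro t ht
      rw [Finset.mem_Ico] at ht
      have htL : (t : ℝ) < L ^ 2 := Nat.lt_ceil.1 ht.2
      have tL : L ≤ t := hLl.trans (by exact_mod_cast ht.1)
      have t0 : (0 : ℝ) < t := by linarith
      have hw0 := wgt_large l t (by omega) ht.1
      have hw : √L / (24 * t * √(t : ℝ)) ≤ wgt l t := by
        refine le_trans ?_ hw0
        gcongr
      have sL : 0 < √L := Real.sqrt_pos.2 hL0
      have st : 0 < √(t : ℝ) := Real.sqrt_pos.2 t0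
      have sL2 : √L ^ 2 = L := Real.sq_sqrt hL0.le
      have st2 : √(t : ℝ) ^ 2 = t := Real.sq_sqrt t0.le
      have sL1 : 1 ≤ √L := Real.one_le_sqrt.2 (by linarith)
      have stL : √(t : ℝ) ≤ L := by
        rw [Real.sqrt_le_left hL0.le]; exact htL.le
      refine le_trans ?_ (seed_fac H t htL.le (wgt l t) ?_)
      · have hx : √(t : ℝ) / √L ≤ 2 ^ 37 * t ^ 2 * wgt l t / L := by
          calc √(t : ℝ) / √L ≤ 2 ^ 37 / 24 * (√(t : ℝ) / √L) := by
                have : 0 ≤ √(t : ℝ) / √L := by positivity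
                linarith
            _ = 2 ^ 37 * t ^ 2 * (√L / (24 * t * √(t : ℝ))) / L := by
                rw [← sL2]
                nth_rewrite 2 3 [← st2]
                field_simp
                rw [sL2, sL2]
            _ ≤ _ := by gcongr
        have hx2 : 2 ^ 30 * (√(t : ℝ) / √L) ≤ 2 ^ 37 * t ^ 2 * wgt l t / L := by
          calc 2 ^ 30 * (√(t : ℝ) / √L) ≤ 2 ^ 37 / 24 * (√(t : ℝ) / √L) := by
                have : 0 ≤ √(t : ℝ) / √L := by positivity
                linarith
            _ = 2 ^ 37 * t ^ 2 * (√L / (24 * t * √(t : ℝ))) / L := by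
                rw [← sL2]
                nth_rewrite 2 3 [← st2]
                field_simp
                rw [sL2, sL2]
            _ ≤ _ := by gcongr
        set x := 2 ^ 37 * t ^ 2 * wgt l t / L with hxd
        have h1 : 1 ≤ √(t : ℝ) / √L := by
          rw [one_le_div sL]; exact Real.sqrt_le_sqrt tL
        refine fac_large (by linarith) (by linarith) ?_
        have e : (√(t : ℝ) / √L) ^ 4 = t ^ 2 / L ^ 2 := by
          rw [div_pow, show 4 = 2 * 2 by norm_num, pow_mul, pow_mul, sL2, st2]
        calc (1 : ℝ) ≤ L ^ 2 / (2 ^ 10 * (t : ℝ) ^ 2) * (2 ^ 120 * (t ^ 2 / L ^ 2)) := by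
              have : L ^ 2 / (2 ^ 10 * (t : ℝ) ^ 2) * (2 ^ 120 * (t ^ 2 / L ^ 2)) = 2 ^ 110 := by
                field_simp
              rw [this]; norm_num
          _ = L ^ 2 / (2 ^ 10 * (t : ℝ) ^ 2) * (2 ^ 30 * (√(t : ℝ) / √L)) ^ 4 := by
              rw [mul_pow, e]; norm_num
          _ ≤ _ := by gcongr
      · have h3 := H.pw 3 (by norm_num)
        have h5 : 2 / n ≤ √L / (24 * t * √(t : ℝ)) := by
          rw [div_le_div_iff₀ hn (by positivity)]
          have : 24 * t * √(t : ℝ) ≤ 24 * L ^ 2 * L := by gcongr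
          have : 1 * (n : ℝ) ≤ √L * n := by gcongr
          have : 0 ≤ L ^ 3 := by positivity
          nlinarith
        have h6 := h5.trans hw
        rw [div_le_iff₀ hn] at h6
        linarith
    · have e : ∑ t ∈ Finset.Ico l T, 48 * (L ^ 2 / (2 ^ 10 * (t : ℝ) ^ 2)) =
          48 * L ^ 2 / 2 ^ 10 * ∑ t ∈ Finset.Ico l T, 1 / (t : ℝ) ^ 2 := by
        rw [Finset.mul_sum]
        refine Finset.sum_congr rfl fun t _ => ?_
        field_simp
      rw [e]
      have h3 := sum_inv_sq l T hl2 hlT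
      have h4 : 0 ≤ 1 / ((T : ℝ) - 1) := by
        have : (l : ℝ) ≤ T := by exact_mod_cast hlT
        apply one_div_nonneg.2; linarith
      have h5 : 1 / ((l : ℝ) - 1) ≤ 2 / L := by
        rw [div_le_div_iff₀ (by linarith) hL0]; linarith
      calc 48 * L ^ 2 / 2 ^ 10 * ∑ t ∈ Finset.Ico l T, 1 / (t : ℝ) ^ 2 ≤ 48 * L ^ 2 / 2 ^ 10 * (2 / L) := by
            gcongr; linarith
        _ = 96 / 2 ^ 10 * L := by field_simp; norm_num
        _ ≤ _ := by linarith
  calc Real.exp (-(L / 2)) = Real.exp (-(L / 4)) * Real.exp (-(L / 4)) := by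
        rw [← Real.exp_add]; ring_nf
    _ ≤ _ := mul_le_mul P1 P2 (Real.exp_pos _).le ((Real.exp_pos _).le.trans P1)

lemma seed_pr {n : ℕ} {p1 p2 L : ℝ} (H : Hyp2 n p1 p2 L) (x : Fin n) :
    Real.exp (-(L / 2)) ≤ Pr (ep (α := Finset (PairVertex n)) p1 p2) (Seed (star' x) ⌈L ^ 2⌉₊) := by
  have hn := H.npos
  have hL := H.L100
  have hL0 : 0 < L := by linarith
  have hLl : L ≤ ⌈L⌉₊ := Nat.le_ceil L
  have hl2 : 2 ≤ ⌈L⌉₊ := by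
    have : (2 : ℝ) ≤ ⌈L⌉₊ := by linarith
    exact_mod_cast this
  have hlT : ⌈L⌉₊ ≤ ⌈L ^ 2⌉₊ := Nat.ceil_mono (by nlinarith)
  refine (seed_low H).trans (seed_prod H.h1 H.h2 _ _ (by omega) _ ?_)
  rw [star_card]
  have h0 : (4 : ℝ) ≤ n := by linarith [H.pw 1 (by norm_num)]
  have h0' : 4 ≤ n := by exact_mod_cast h0
  have key : ((1 + ∑ t ∈ Finset.Ico 1 ⌈L ^ 2⌉₊, ⌊n * wgt ⌈L⌉₊ t⌋₊ : ℕ) : ℝ) ≤ ((n - 1 : ℕ) : ℝ) := by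
    rw [Nat.cast_sub (by omega)]
    push_cast
    have h1 : ∑ t ∈ Finset.Ico 1 ⌈L ^ 2⌉₊, ((⌊n * wgt ⌈L⌉₊ t⌋₊ : ℕ) : ℝ) ≤
        ∑ t ∈ Finset.Ico 1 ⌈L ^ 2⌉₊, n * wgt ⌈L⌉₊ t := by
      refine Finset.sum_le_sum fun t ht => Nat.floor_le ?_
      refine mul_nonneg hn.le ?_
      by_cases h : t < ⌈L⌉₊
      · rw [wgt, if_pos h]; positivity
      · exact le_trans (by positivity) (wgt_large _ _ (by omega) (by omega))
    rw [← Finset.mul_sum] at h1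
    have h2 := mul_le_mul_of_nonneg_left (wgt_sum _ _ hl2 hlT) hn.le
    linarith
  exact_mod_cast key

end JigsawSeedProb


noncomputable section JigsawFinal
open scoped Classical
set_option linter.unusedSectionVars false
set_option linter.unusedVariables false

lemma Hyp2.nexp {n : ℕ} {p1 p2 L : ℝ} (H : Hyp2 n p1 p2 L) : (n : ℝ) = Real.exp L := by
  rw [H.hL, Real.exp_log H.npos]

lemma one_sub_qv_le {n : ℕ} {p1 p2 L : ℝ} (H : Hyp2 n p1 p2 L) (t : ℕ) :
    1 - qv p1 p2 t ≤ Real.exp (1 - t * (2 ^ 40 * L / n)) := by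
  have a1 := one_sub_pow_exp H.h1 t
  have a2 := one_sub_pow_exp H.h2 t
  have t0 : (0 : ℝ) ≤ t := by positivity
  have c1 : t * (2 ^ 40 * L / n) ≤ t * p1 := mul_le_mul_of_nonneg_left H.m1 t0
  have c2 : t * (2 ^ 40 * L / n) ≤ t * p2 := mul_le_mul_of_nonneg_left H.m2 t0
  have d1 : Real.exp (-(t * p1)) ≤ Real.exp (-(t * (2 ^ 40 * L / n))) := Real.exp_le_exp.2 (by linarith)
  have d2 : Real.exp (-(t * p2)) ≤ Real.exp (-(t * (2 ^ 40 * L / n))) := Real.exp_le_exp.2 (by linarith)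
  have g1 : 0 ≤ (1 - p1) ^ t := pow_nonneg (by linarith [H.h1.2]) t
  have g2 : 0 ≤ (1 - p2) ^ t := pow_nonneg (by linarith [H.h2.2]) t
  have e : Real.exp (1 - t * (2 ^ 40 * L / n)) = Real.exp 1 * Real.exp (-(t * (2 ^ 40 * L / n))) := by
    rw [← Real.exp_add]; ring_nf
  rw [e, qv]
  have h2 : 2 ≤ Real.exp 1 := by linarith [Real.add_one_le_exp 1]
  have := Real.exp_pos (-(t * (2 ^ 40 * L / n)))
  nlinarith [mul_nonneg g1 g2]

lemma exp_term {n : ℕ} {p1 p2 L : ℝ} (H : Hyp2 n p1 p2 L) (t : ℕ) (ht : L ^ 2 ≤ t) (htm : t < n - 1) :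
    ((n - 1).choose t : ℝ) * (1 - qv p1 p2 t) ^ (n - 1 - t) ≤ Real.exp (-(3 * L)) := by
  have hn := H.npos
  have hL := H.L100
  have hL0 : 0 < L := by linarith
  have hbig := H.pw 1 (by norm_num)
  have ne := H.nexp
  have hq := qv_mem H.h1 H.h2 t
  obtain ⟨u, hu⟩ : ∃ u, n - 1 = t + u := ⟨n - 1 - t, by omega⟩
  have hnu : (n : ℝ) = t + u + 1 := by
    have : n = t + u + 1 := by omega
    exact_mod_cast this
  have hu1 : (1 : ℝ) ≤ u := by exact_mod_cast (by omega : 1 ≤ u)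
  rw [hu, Nat.add_sub_cancel_left]
  have t1 : 1 ≤ (t : ℝ) := by nlinarith
  have t0 : 0 < (t : ℝ) := by linarith
  have hmn : ((t + u : ℕ) : ℝ) ≤ n := by push_cast; linarith
  have C1 : ((t + u).choose t : ℝ) ≤ Real.exp (t * L) := by
    calc ((t + u).choose t : ℝ) ≤ ((t + u : ℕ) : ℝ) ^ t := by exact_mod_cast Nat.choose_le_pow _ _
      _ ≤ (n : ℝ) ^ t := by gcongr
      _ = _ := by rw [ne, ← Real.exp_nat_mul]
  have C2 : ((t + u).choose t : ℝ) ≤ Real.exp (u * L) := by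
    have e : (t + u).choose t = (t + u).choose u := Nat.choose_symm_add
    rw [e]
    calc ((t + u).choose u : ℝ) ≤ ((t + u : ℕ) : ℝ) ^ u := by exact_mod_cast Nat.choose_le_pow _ _
      _ ≤ (n : ℝ) ^ u := by gcongr
      _ = _ := by rw [ne, ← Real.exp_nat_mul]
  have C3 : ((t + u).choose t : ℝ) ≤ Real.exp n := by
    calc ((t + u).choose t : ℝ) ≤ (2 : ℝ) ^ (t + u) := by exact_mod_cast Nat.choose_le_two_pow _ _
      _ ≤ Real.exp 1 ^ (t + u) := by gcongr; linarith [Real.add_one_le_exp 1]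
      _ = Real.exp ((t + u : ℕ) : ℝ) := by rw [← Real.exp_nat_mul, mul_one]
      _ ≤ _ := Real.exp_le_exp.2 hmn
  have Q : ∀ y : ℝ, y ≤ t * (2 ^ 40 * L / n) - 1 → (1 - qv p1 p2 t) ^ u ≤ Real.exp (-(u * y)) := by
    intro y hy
    have h1 := (one_sub_qv_le H t).trans (Real.exp_le_exp.2 (by linarith : _ ≤ -y))
    calc (1 - qv p1 p2 t) ^ u ≤ Real.exp (-y) ^ u := by
          gcongr; linarith [hq.2]
      _ = _ := by rw [← Real.exp_nat_mul]; ring_nf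
  have qn : 0 ≤ (1 - qv p1 p2 t) ^ u := pow_nonneg (by linarith [hq.2]) u
  rcases le_total (48 * t * L) n with hA | hA
  · -- small
    have hq2 : 12 * t * L / n ≤ qv p1 p2 t := by
      have := qv_lower H t (48 * t * L / n) (by rw [div_le_one hn]; exact hA) ?_ ?_
      · refine le_trans (le_of_eq ?_) this; ring
      · rw [← mul_div_assoc, div_le_div_iff₀ hn (by positivity)]
        have : 48 * L * L ≤ t * 2 ^ 40 := by nlinarith
        have := mul_le_mul_of_nonneg_left this (by positivity : 0 ≤ t * (n : ℝ))
        linarith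
      · rw [← mul_div_assoc]
        gcongr ?_ / _
        nlinarith [mul_pos t0 hL0]
    have hu3 : (n : ℝ) / 3 ≤ u := by nlinarith
    have h2 : (1 - qv p1 p2 t) ^ u ≤ Real.exp (-(4 * t * L)) := by
      refine (one_sub_pow_exp hq u).trans (Real.exp_le_exp.2 (neg_le_neg ?_))
      calc 4 * t * L = n / 3 * (12 * t * L / n) := by field_simp; norm_num
        _ ≤ _ := by gcongr
    calc ((t + u).choose t : ℝ) * (1 - qv p1 p2 t) ^ u ≤ Real.exp (t * L) * Real.exp (-(4 * t * L)) := by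
          gcongr
      _ = Real.exp (-(3 * L) * t) := by rw [← Real.exp_add]; ring_nf
      _ ≤ _ := Real.exp_le_exp.2 (by nlinarith)
  · rcases le_total (t : ℝ) u with hB | hB
    · have hy : 10 ≤ t * (2 ^ 40 * L / n) - 1 := by
        have : (11 : ℝ) ≤ t * (2 ^ 40 * L / n) := by
          rw [← mul_div_assoc, le_div_iff₀ hn]; nlinarith
        linarith
      have h2 := Q 10 hy
      calc ((t + u).choose t : ℝ) * (1 - qv p1 p2 t) ^ u ≤ Real.exp n * Real.exp (-(u * 10)) := by
            gcongr
        _ = Real.exp (n - u * 10) := by rw [← Real.exp_add]; ring_nf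
        _ ≤ _ := Real.exp_le_exp.2 (by linarith)
    · have hy : 4 * L ≤ t * (2 ^ 40 * L / n) - 1 := by
        have : 5 * L ≤ t * (2 ^ 40 * L / n) := by
          rw [← mul_div_assoc, le_div_iff₀ hn]; nlinarith
        linarith
      have h2 := Q (4 * L) hy
      calc ((t + u).choose t : ℝ) * (1 - qv p1 p2 t) ^ u ≤ Real.exp (u * L) * Real.exp (-(u * (4 * L))) := by
            gcongr
        _ = Real.exp (-(3 * L) * u) := by rw [← Real.exp_add]; ring_nf
        _ ≤ _ := Real.exp_le_exp.2 (by nlinarith)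

def ExpFail (n T : ℕ) (ω : Finset (PairVertex n) × Bool → Bool) : Prop :=
  ∃ x ∈ (Finset.univ : Finset (Fin n)), ∃ t ∈ Finset.Ico T (n - 1), ∃ S ∈ (star' x).powersetCard t,
    ∀ w ∈ star' x \ S, ¬ Join w S ω

lemma exp_pr {n : ℕ} {p1 p2 L : ℝ} (H : Hyp2 n p1 p2 L) :
    Pr (ep (α := Finset (PairVertex n)) p1 p2) (ExpFail n ⌈L ^ 2⌉₊) ≤ 1 / n := by
  have hp := ep_mem (α := Finset (PairVertex n)) H.h1 H.h2
  have hn := H.npos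
  have key : ∀ x : Fin n, ∀ t ∈ Finset.Ico ⌈L ^ 2⌉₊ (n - 1),
      Pr (ep (α := Finset (PairVertex n)) p1 p2) (fun ω => ∃ S ∈ (star' x).powersetCard t,
        ∀ w ∈ star' x \ S, ¬ Join w S ω) ≤ Real.exp (-(3 * L)) := by
    intro x t ht
    rw [Finset.mem_Ico] at ht
    refine (Pr_exists_le hp _ _).trans (le_trans (le_of_eq ?_)
      (exp_term H t (Nat.ceil_le.1 ht.1) ht.2))
    rw [Finset.sum_congr rfl (g := fun _ => (1 - qv p1 p2 t) ^ (n - 1 - t))]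
    · rw [Finset.sum_const, Finset.card_powersetCard, star_card, nsmul_eq_mul]
    · intro S hS
      rw [Finset.mem_powersetCard] at hS
      have := prob_nojoin p1 p2 (star' x \ S) S Finset.sdiff_disjoint
      rw [Finset.card_sdiff_of_subset hS.1, star_card, hS.2] at this
      exact this
  refine (Pr_exists_le hp _ _).trans ?_
  refine (Finset.sum_le_sum fun x _ => (Pr_exists_le hp _ _).trans (Finset.sum_le_sum (key x))).trans ?_
  rw [Finset.sum_const, Finset.sum_const, Nat.card_Ico, Finset.card_univ, Fintype.card_fin,
    nsmul_eq_mul, nsmul_eq_mul]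
  have h1 : ((n - 1 - ⌈L ^ 2⌉₊ : ℕ) : ℝ) ≤ n := by
    have : n - 1 - ⌈L ^ 2⌉₊ ≤ n := by omega
    exact_mod_cast this
  have h2 : Real.exp (-(3 * L)) = 1 / (n : ℝ) ^ 3 := by
    rw [H.nexp, ← Real.exp_nat_mul, Real.exp_neg, one_div]; norm_num
  calc (n : ℝ) * (((n - 1 - ⌈L ^ 2⌉₊ : ℕ) : ℝ) * Real.exp (-(3 * L))) ≤ n * (n * (1 / (n : ℝ) ^ 3)) := by
        rw [h2]; gcongr
    _ = _ := by field_simp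

def FewSeeds (n T : ℕ) (ω : Finset (PairVertex n) × Bool → Bool) : Prop :=
  ∃ Y ∈ (Finset.univ : Finset (Fin n)).powersetCard (n - T), ∀ x ∈ Y, ¬ Seed (star' x) T ω

lemma few_pr {n : ℕ} {p1 p2 L : ℝ} (H : Hyp2 n p1 p2 L) :
    Pr (ep (α := Finset (PairVertex n)) p1 p2) (FewSeeds n ⌈L ^ 2⌉₊) ≤ 1 / n := by
  have hp := ep_mem (α := Finset (PairVertex n)) H.h1 H.h2
  have hn := H.npos
  have hL := H.L100
  have hL0 : 0 < L := by linarith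
  set T := ⌈L ^ 2⌉₊ with hT
  have hTL : (T : ℝ) ≤ 2 * L ^ 2 := by
    have := Nat.ceil_lt_add_one (by positivity : 0 ≤ L ^ 2)
    nlinarith
  have hT2 : (T : ℝ) ≤ n / 2 := by linarith [H.pw 2 (by norm_num), (by positivity : 0 ≤ L ^ 2)]
  have hTn : T ≤ n := by
    have : (T : ℝ) ≤ n := by linarith
    exact_mod_cast this
  set ρ := Real.exp (-(L / 2)) with hρ
  have hρ1 : ρ ≤ 1 := Real.exp_le_one_iff.2 (by linarith)
  have key : ∀ Y ∈ (Finset.univ : Finset (Fin n)).powersetCard (n - T),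
      Pr (ep (α := Finset (PairVertex n)) p1 p2) (fun ω => ∀ x ∈ Y, ¬ Seed (star' x) T ω) ≤
        Real.exp (-((n - T : ℕ) * ρ)) := by
    intro Y hY
    rw [Pr_forall _ Y (fun x ω => ¬ Seed (star' x) T ω) (fun x => inD (star' x))
      (fun x _ => (seed_det _ _).not) (fun x _ y _ hne => star_det_disj hne)]
    have : ∀ x ∈ Y, Pr (ep (α := Finset (PairVertex n)) p1 p2) (fun ω => ¬ Seed (star' x) T ω) ≤ 1 - ρ := by
      intro x _
      rw [Pr_not]
      have := seed_pr H x
      linarith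
    refine (Finset.prod_le_prod (fun x _ => Pr_nonneg hp _) this).trans ?_
    rw [Finset.prod_const, (Finset.mem_powersetCard.1 hY).2]
    exact one_sub_pow_exp ⟨(Real.exp_pos _).le, hρ1⟩ _
  refine (Pr_exists_le hp _ _).trans ((Finset.sum_le_sum key).trans ?_)
  rw [Finset.sum_const, Finset.card_powersetCard, Finset.card_univ, Fintype.card_fin, nsmul_eq_mul,
    Nat.choose_symm hTn]
  have C : (n.choose T : ℝ) ≤ Real.exp (T * L) := by
    calc (n.choose T : ℝ) ≤ (n : ℝ) ^ T := by exact_mod_cast Nat.choose_le_pow _ _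
      _ = _ := by rw [H.nexp, ← Real.exp_nat_mul]
  have e1 : 2 ^ 25 * L ^ 4 ≤ Real.exp (L / 2) := by
    refine le_of_sq_le_sq ?_ (Real.exp_pos _).le
    rw [← Real.exp_nat_mul]
    have : ((2 : ℕ) : ℝ) * (L / 2) = L := by push_cast; ring
    rw [this, ← H.nexp]
    refine le_trans (le_of_eq ?_) H.big
    ring
  have e2 : Real.exp (L / 2) / 2 ≤ ((n - T : ℕ) : ℝ) * ρ := by
    rw [Nat.cast_sub hTn]
    have : (n : ℝ) * ρ = Real.exp (L / 2) := by
      rw [H.nexp, hρ, ← Real.exp_add]; ring_nf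
    rw [← this]
    have := Real.exp_pos (-(L / 2))
    nlinarith
  have e3 : (1 : ℝ) / n = Real.exp (-L) := by rw [H.nexp, Real.exp_neg, one_div]
  rw [e3]
  calc (n.choose T : ℝ) * Real.exp (-(((n - T : ℕ) : ℝ) * ρ)) ≤
        Real.exp (T * L) * Real.exp (-(Real.exp (L / 2) / 2)) := by gcongr
    _ = Real.exp (T * L - Real.exp (L / 2) / 2) := by rw [← Real.exp_add]; ring_nf
    _ ≤ _ := by
      apply Real.exp_le_exp.2
      have h1 : T * L ≤ 2 * L ^ 2 * L := by gcongr
      have h2 : L ≤ L ^ 3 := le_self_pow₀ (by linarith) (by norm_num)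
      have h3 : L ^ 3 ≤ L ^ 4 := pow_le_pow_right₀ (by linarith) (by norm_num)
      nlinarith

lemma part2_fin {n : ℕ} {p1 p2 L : ℝ} (H : Hyp2 n p1 p2 L) :
    1 - 2 / (n : ℝ) ≤ Pr (ep (α := Finset (PairVertex n)) p1 p2) (fun ω =>
      JPercolates 1 (Ecol (lineGroundEdges n) true ω) (Ecol (lineGroundEdges n) false ω)) := by
  have hp := ep_mem (α := Finset (PairVertex n)) H.h1 H.h2
  have hL := H.L100
  set T := ⌈L ^ 2⌉₊ with hT
  have hT1 : 1 ≤ T := Nat.one_le_iff_ne_zero.2 (by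
    have : 0 < T := Nat.ceil_pos.2 (by positivity)
    omega)
  have hn := H.npos
  have h1 : Pr (ep (α := Finset (PairVertex n)) p1 p2) (fun ω =>
      ¬ JPercolates 1 (Ecol (lineGroundEdges n) true ω) (Ecol (lineGroundEdges n) false ω)) ≤
      Pr (ep (α := Finset (PairVertex n)) p1 p2) (fun ω => ExpFail n T ω ∨ FewSeeds n T ω) := by
    refine Pr_mono hp fun ω h => ?_
    by_contra hc
    rw [not_or] at hc
    obtain ⟨hE, hF⟩ := hc
    apply h
    set X := (Finset.univ : Finset (Fin n)).filter fun x => Seed (star' x) T ω with hX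
    refine star_percolates hT1 ?_ X ?_ ?_
    · intro x S hS hc hne
      by_contra hno
      push Not at hno
      refine hE ⟨x, by simp, S.card, Finset.mem_Ico.2 ⟨hc, ?_⟩, S,
        Finset.mem_powersetCard.2 ⟨hS, rfl⟩, hno⟩
      rw [← star_card x]
      exact Finset.card_lt_card (Finset.ssubset_iff_subset_ne.2 ⟨hS, hne⟩)
    · by_contra hlt
      push Not at hlt
      have hc : (Finset.univ \ X).card = n - X.card := by
        rw [Finset.card_sdiff_of_subset (Finset.subset_univ _), Finset.card_univ, Fintype.card_fin]
      obtain ⟨Y, hY, hYc⟩ := Finset.exists_subset_card_eq (s := Finset.univ \ X) (n := n - T) (by omega)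
      refine hF ⟨Y, Finset.mem_powersetCard.2 ⟨Finset.subset_univ _, hYc⟩, ?_⟩
      intro x hx hs
      have := hY hx
      rw [Finset.mem_sdiff] at this
      exact this.2 (Finset.mem_filter.2 ⟨by simp, hs⟩)
    · intro x hx
      exact (Finset.mem_filter.1 hx).2
  have h2 := h1.trans (Pr_or_le hp _ _)
  rw [Pr_not] at h2
  have h3 := exp_pr H
  have h4 := few_pr H
  have : 2 / (n : ℝ) = 1 / n + 1 / n := by ring
  rw [this]
  have h3' : Pr (ep (α := Finset (PairVertex n)) p1 p2) (fun ω => ExpFail n T ω) ≤ 1 / n := h3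
  have h4' : Pr (ep (α := Finset (PairVertex n)) p1 p2) (fun ω => FewSeeds n T ω) ≤ 1 / n := h4
  linarith

lemma ev_big : ∀ᶠ n : ℕ in atTop, 2 ^ 50 * Real.log n ^ 8 ≤ (n : ℝ) := by
  have h := (Real.isLittleO_pow_log_id_atTop (n := 8)).bound (by norm_num : (0 : ℝ) < 1 / 2 ^ 50)
  have h2 := tendsto_natCast_atTop_atTop (R := ℝ) |>.eventually h
  filter_upwards [h2] with n hn
  simp only [id, Real.norm_eq_abs] at hn
  have h3 := le_abs_self (Real.log n ^ 8)
  rw [abs_of_nonneg (by positivity : (0 : ℝ) ≤ n)] at hn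
  linarith

lemma part2_main (p1 p2 : ℕ → ℝ) (h1 : ∀ n, 0 ≤ p1 n ∧ p1 n ≤ 1) (h2 : ∀ n, 0 ≤ p2 n ∧ p2 n ≤ 1)
    (hx : ∀ᶠ n : ℕ in atTop, 2 ^ 40 / ((n : ℝ) * Real.log n) ≤ p1 n * p2 n ∧
            2 ^ 40 * Real.log n / (n : ℝ) ≤ min (p1 n) (p2 n)) :
    Tendsto (fun n : ℕ => probDouble (lineGroundEdges n) (p1 n) (p2 n)
              fun E1 E2 => JPercolates 1 E1 E2) atTop (nhds 1) := by
  have hlog : ∀ᶠ n : ℕ in atTop, 100 ≤ Real.log n :=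
    (Real.tendsto_log_atTop.comp tendsto_natCast_atTop_atTop).eventually_ge_atTop 100
  have hlim : Tendsto (fun n : ℕ => 1 - 2 / (n : ℝ)) atTop (nhds 1) := by
    have := (tendsto_const_div_atTop_nhds_zero_nat (2 : ℝ)).const_sub 1
    simpa using this
  refine tendsto_of_tendsto_of_tendsto_of_le_of_le' hlim tendsto_const_nhds ?_ ?_
  · filter_upwards [hlog, hx, ev_big] with n hn hxn hb
    rw [probDouble_eq]
    exact part2_fin (L := Real.log n) ⟨rfl, h1 n, h2 n, hn, hb, hxn.1,
      hxn.2.trans (min_le_left _ _), hxn.2.trans (min_le_right _ _)⟩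
  · filter_upwards with n
    rw [probDouble_eq]
    exact Pr_le_one (ep_mem (h1 n) (h2 n)) _

end JigsawFinal

/-- **Theorem (line graphs).** Let `H ~ L(n,p1,p2)` be the random double graph on the pairs
of `[n]`, in which any two intersecting pairs form a red edge with probability `p1` and a
blue edge with probability `p2`, independently.  There is a constant `c > 0` such that:
(1) if `p1·p2 ≤ 1/(c·n·log n)` then whp `H` does not percolate;
(2) if `p1·p2 ≥ c/(n·log n)` and `min{p1,p2} ≥ c·log n/n` then whp `H` percolates.
(Graph jigsaw percolation on clusters of vertices is `1`-jigsaw percolation.) -/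
theorem line_graph_jigsaw_threshold :
    ∃ c : ℝ, 0 < c ∧
      ∀ p1 p2 : ℕ → ℝ,
        (∀ n, 0 ≤ p1 n ∧ p1 n ≤ 1) →
        (∀ n, 0 ≤ p2 n ∧ p2 n ≤ 1) →
        ((∀ᶠ n : ℕ in atTop, p1 n * p2 n ≤ 1 / (c * (n : ℝ) * Real.log n)) →
          Tendsto
            (fun n : ℕ => probDouble (lineGroundEdges n) (p1 n) (p2 n)
              fun E1 E2 => ¬ JPercolates 1 E1 E2)
            atTop (nhds 1)) ∧
        ((∀ᶠ n : ℕ in atTop,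
            c / ((n : ℝ) * Real.log n) ≤ p1 n * p2 n ∧
            c * Real.log n / (n : ℝ) ≤ min (p1 n) (p2 n)) →
          Tendsto
            (fun n : ℕ => probDouble (lineGroundEdges n) (p1 n) (p2 n)
              fun E1 E2 => JPercolates 1 E1 E2)
            atTop (nhds 1)) := by
  refine ⟨2 ^ 40, by norm_num, fun p1 p2 h1 h2 => ⟨fun hx => ?_, fun hx => part2_main p1 p2 h1 h2 hx⟩⟩
  refine part1_main p1 p2 h1 h2 ?_
  filter_upwards [hx, eventually_ge_atTop 2] with n hn h2n
  refine hn.trans ?_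
  have hn1 : (1 : ℝ) < n := by exact_mod_cast h2n
  have hlog : 0 < Real.log n := Real.log_pos hn1
  have hn0 : (0 : ℝ) < n := by linarith
  apply one_div_le_one_div_of_le (by positivity)
  gcongr <;> norm_num
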